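/- arXiv:1708.01426 — 3 statements merged into one kernel-verified Lean document; each statement's English description precedes it below -/
import Mathlib

section
/- First fundamental theorem of invariants in the stable range (Theorem 3.1(i), first part). Assume m ≥ 2k. A polynomial P ∈ P is SO(m)-invariant, i.e., g·P = P for every g ∈ SO(m), if and only if P belongs to the unital ℂ-subalgebra of P generated by the polynomials r²_ij, 1 ≤ i ≤ j ≤ k. -/
open scoped TensorProduct

noncomputable section

/-- Scalar polynomials in the m·k variables x_{li}. -/
abbrev Pscal (m k : ℕ) := MvPolynomial (Fin m × Fin k) ℂ

/-- The quadratic form Q(z) = -(z₁² + ⋯ + z_m²) on ℂ^m. -/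
def Qf (m : ℕ) : QuadraticForm ℂ (Fin m → ℂ) :=
  QuadraticMap.weightedSumSquares ℂ (fun _ : Fin m => (-1 : ℂ))

/-- The complex Clifford algebra C_m. -/
abbrev Cl (m : ℕ) := CliffordAlgebra (Qf m)

/-- The generator e_l of the Clifford algebra. -/
def e (m : ℕ) (l : Fin m) : Cl m := CliffordAlgebra.ι (Qf m) (Pi.single l 1)

/-- C_m-valued polynomials. -/
abbrev PC (m k : ℕ) := Pscal m k ⊗[ℂ] Cl m

/-- Partial derivative ∂_{x_{li}} acting on C_m-valued polynomials. -/
def pd (m k : ℕ) (l : Fin m) (i : Fin k) : PC m k →ₗ[ℂ] PC m k :=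
  LinearMap.rTensor (Cl m) (MvPolynomial.pderiv (l, i)).toLinearMap

/-- The j-th Dirac operator ∂_{x_j} = Σ_l e_l ∂_{x_{lj}}. -/
def dirac (m k : ℕ) (j : Fin k) : PC m k →ₗ[ℂ] PC m k :=
  ∑ l : Fin m,
    (LinearMap.mulLeft ℂ ((1 : Pscal m k) ⊗ₜ[ℂ] e m l)) ∘ₗ pd m k l j

/-- The space M of monogenic polynomials. -/
def Mono (m k : ℕ) : Submodule ℂ (PC m k) :=
  ⨅ j : Fin k, LinearMap.ker (dirac m k j)

/-- The j-th vector variable x_j = Σ_l e_l x_{lj}. -/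
def xv (m k : ℕ) (j : Fin k) : PC m k :=
  ∑ l : Fin m, (MvPolynomial.X (l, j) : Pscal m k) ⊗ₜ[ℂ] e m l

/-- For J = {j₁ < ⋯ < j_r} ⊆ {1,…,k}, the product x_J = x_{j₁} ⋯ x_{j_r}. -/
def xJ (m k : ℕ) (J : Finset (Fin k)) : PC m k :=
  ((J.sort (· ≤ ·)).map (xv m k)).prod

/-- The invariant r²_ij = Σ_l x_{li} x_{lj}. -/
def rP (m k : ℕ) (i j : Fin k) : Pscal m k :=
  ∑ l : Fin m, MvPolynomial.X (l, i) * MvPolynomial.X (l, j)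

/-- Products ∏_{1≤i≤j≤k} r_ij^{2 n_ij} indexed by finitely supported families. -/
def rprod (m k : ℕ) (n : {p : Fin k × Fin k // p.1 ≤ p.2} →₀ ℕ) : Pscal m k :=
  n.prod fun p e => rP m k p.1.1 p.1.2 ^ (2 * e)

/-- The element (∏ r_ij^{2n_ij}) · x_J of P⊗C_m. -/
def basisElem (m k : ℕ) (J : Finset (Fin k))
    (n : {p : Fin k × Fin k // p.1 ≤ p.2} →₀ ℕ) : PC m k :=
  (rprod m k n ⊗ₜ[ℂ] (1 : Cl m)) * xJ m k J

/-- The operator Δ_ij = Σ_l ∂_{x_{li}} ∂_{x_{lj}} on scalar polynomials. -/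
def lap (m k : ℕ) (i j : Fin k) : Pscal m k →ₗ[ℂ] Pscal m k :=
  ∑ l : Fin m,
    (MvPolynomial.pderiv (l, i)).toLinearMap ∘ₗ (MvPolynomial.pderiv (l, j)).toLinearMap

/-- The space H of harmonic scalar polynomials. -/
def Harm (m k : ℕ) : Submodule ℂ (Pscal m k) :=
  ⨅ p : {p : Fin k × Fin k // p.1 ≤ p.2}, LinearMap.ker (lap m k p.1.1 p.1.2)

/-- The operator Δ_ij acting on C_m-valued polynomials. -/
def lapC (m k : ℕ) (i j : Fin k) : PC m k →ₗ[ℂ] PC m k :=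
  ∑ l : Fin m, pd m k l i ∘ₗ pd m k l j

/-- The space of C_m-valued harmonic polynomials. -/
def HarmC (m k : ℕ) : Submodule ℂ (PC m k) :=
  ⨅ p : {p : Fin k × Fin k // p.1 ≤ p.2}, LinearMap.ker (lapC m k p.1.1 p.1.2)

/-- The operator E_ij = Σ_l x_{li} ∂_{x_{lj}} acting on C_m-valued polynomials. -/
def Eop (m k : ℕ) (i j : Fin k) : PC m k →ₗ[ℂ] PC m k :=
  ∑ l : Fin m,
    (LinearMap.mulLeft ℂ ((MvPolynomial.X (l, i) : Pscal m k) ⊗ₜ[ℂ] (1 : Cl m))) ∘ₗ pd m k l j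

/-- The space M^S of simplicial monogenic polynomials. -/
def SimpMono (m k : ℕ) : Submodule ℂ (PC m k) :=
  Mono m k ⊓ ⨅ p : {p : Fin k × Fin k // p.1 < p.2}, LinearMap.ker (Eop m k p.1.1 p.1.2)

/-- Scalar polynomials homogeneous of total degree ℓ. -/
abbrev Pdeg (m k : ℕ) (ℓ : ℕ) : Submodule ℂ (Pscal m k) :=
  MvPolynomial.homogeneousSubmodule (Fin m × Fin k) ℂ ℓ

/-- Scalar homogeneous polynomials, zero in negative degrees. -/
def PdegZ (m k : ℕ) (n : ℤ) : Submodule ℂ (Pscal m k) :=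
  if 0 ≤ n then Pdeg m k n.toNat else ⊥

/-- C_m-valued polynomials homogeneous of total degree ℓ. -/
def PCdeg (m k : ℕ) (ℓ : ℕ) : Submodule ℂ (PC m k) :=
  LinearMap.range (LinearMap.rTensor (Cl m) (Pdeg m k ℓ).subtype)

/-- C_m-valued homogeneous polynomials, zero in negative degrees. -/
def PCdegZ (m k : ℕ) (n : ℤ) : Submodule ℂ (PC m k) :=
  if 0 ≤ n then PCdeg m k n.toNat else ⊥

/-- Monogenic polynomials homogeneous of given degree, zero in negative degrees. -/
def MdegZ (m k : ℕ) (n : ℤ) : Submodule ℂ (PC m k) :=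
  if 0 ≤ n then Mono m k ⊓ PCdeg m k n.toNat else ⊥

/-- C_m-valued polynomials multihomogeneous of degree a_i in the i-th column x_{1i},…,x_{mi}. -/
def PCmdeg (m k : ℕ) (a : Fin k → ℕ) : Submodule ℂ (PC m k) :=
  LinearMap.range (LinearMap.rTensor (Cl m)
    (MvPolynomial.weightedHomogeneousSubmodule ℂ
      (fun p : Fin m × Fin k => Pi.single p.2 1) a).subtype)

/-- The action of SO(m) on scalar polynomials by x_{li} ↦ Σ_s g_{sl} x_{si}. -/
def soAct (m k : ℕ) (g : Matrix (Fin m) (Fin m) ℝ) : Pscal m k →ₐ[ℂ] Pscal m k :=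
  MvPolynomial.aeval fun p : Fin m × Fin k =>
    ∑ s : Fin m, MvPolynomial.C (g s p.1 : ℂ) * MvPolynomial.X (s, p.2)

/-- The Fischer inner product on scalar polynomials. -/
def fischer (m k : ℕ) (f g : Pscal m k) : ℂ :=
  ∑ α ∈ f.support,
    (α.prod fun _ e => (Nat.factorial e : ℂ)) * (starRingEnd ℂ) (f.coeff α) * g.coeff α

end

noncomputable def ev {m k : ℕ} (P : Pscal m k) (C : Fin k → Fin m → ℂ) : ℂ :=
  MvPolynomial.eval (fun p => C p.2 p.1) P

noncomputable def rf {m : ℕ} {F : Type*} [Field F] (v x : Fin m → F) : Fin m → F :=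
  x - (2 * (v ⬝ᵥ x) / (v ⬝ᵥ v)) • v

theorem rf_smul_self {m : ℕ} {F : Type*} [Field F] (v x : Fin m → F) (hv : v ⬝ᵥ v ≠ 0) :
    rf v ((v ⬝ᵥ v) • x) = (v ⬝ᵥ v) • x - (2 * (v ⬝ᵥ x)) • v := by
  simp only [rf, dotProduct_smul, smul_eq_mul]
  congr 2
  field_simp

theorem easy_dir (m k : ℕ) (P : Pscal m k)
    (h : P ∈ Algebra.adjoin ℂ {q : Pscal m k | ∃ i j : Fin k, i ≤ j ∧ q = rP m k i j})
    (g : Matrix (Fin m) (Fin m) ℝ) (hg : g.transpose * g = 1) : soAct m k g P = P := by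
  have hg' : g * g.transpose = 1 := mul_eq_one_comm.mp hg
  have key : Algebra.adjoin ℂ {q : Pscal m k | ∃ i j : Fin k, i ≤ j ∧ q = rP m k i j} ≤
      AlgHom.equalizer (soAct m k g) (AlgHom.id ℂ _) := by
    rw [Algebra.adjoin_le_iff]
    rintro _ ⟨i, j, -, rfl⟩
    change soAct m k g (rP m k i j) = rP m k i j
    simp only [rP, map_sum, map_mul, soAct, MvPolynomial.aeval_X]
    have h1 : ∀ s t, ∑ l, (g s l : ℂ) * (g t l : ℂ) = if s = t then 1 else 0 := by
      intro s t
      have := congrFun (congrFun hg' s) t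
      rw [Matrix.mul_apply, Matrix.one_apply] at this
      simp only [Matrix.transpose_apply] at this
      have h2 := congrArg (fun x : ℝ => (x : ℂ)) this
      push_cast at h2
      rw [h2]
      split_ifs <;> simp
    calc _ = ∑ s, ∑ t, MvPolynomial.C (∑ l, (g s l : ℂ) * (g t l : ℂ)) *
        ((MvPolynomial.X (s, i) : Pscal m k) * MvPolynomial.X (t, j)) := by
          simp only [map_sum, Finset.sum_mul]
          simp only [Finset.mul_sum]
          rw [Finset.sum_comm]
          refine Finset.sum_congr rfl fun s _ => ?_
          rw [Finset.sum_comm]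
          refine Finset.sum_congr rfl fun t _ => Finset.sum_congr rfl fun l _ => ?_
          simp only [map_mul]; ring
      _ = _ := by
          simp only [h1]
          refine Finset.sum_congr rfl fun s _ => ?_
          rw [Finset.sum_eq_single s]
          · simp
          · intro t _ ht; simp [ht.symm]
          · simp
  exact key h

/-- reflection matrix -/
noncomputable def rmat {m : ℕ} (v : Fin m → ℝ) : Matrix (Fin m) (Fin m) ℝ :=
  1 - (2 / (v ⬝ᵥ v)) • Matrix.vecMulVec v v

theorem rmat_transpose {m : ℕ} (v : Fin m → ℝ) : (rmat v).transpose = rmat v := by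
  simp [rmat, Matrix.transpose_vecMulVec]

theorem rmat_mul {m : ℕ} (v x : Fin m → ℝ) : (rmat v).mulVec x = rf v x := by
  ext l
  simp [rmat, rf, Matrix.sub_mulVec, Matrix.smul_mulVec, Matrix.vecMulVec_mulVec]
  ring

theorem rmat_sq {m : ℕ} (v : Fin m → ℝ) (hv : v ⬝ᵥ v ≠ 0) : rmat v * rmat v = 1 := by
  simp only [rmat, mul_sub, sub_mul, Matrix.mul_smul, Matrix.smul_mul,
    Matrix.vecMulVec_mul_vecMulVec, mul_one, one_mul]
  ext i j
  simp [Matrix.vecMulVec_apply]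
  field_simp
  ring

theorem rmat_det {m : ℕ} (v : Fin m → ℝ) (hv : v ⬝ᵥ v ≠ 0) : (rmat v).det = -1 := by
  have : rmat v = 1 + Matrix.vecMulVec (-(2 / (v ⬝ᵥ v)) • v) v := by
    rw [rmat, Matrix.smul_vecMulVec, neg_smul, sub_eq_add_neg]
  rw [this, Matrix.vecMulVec_eq Unit, Matrix.det_one_add_replicateCol_mul_replicateRow]
  simp
  field_simp
  norm_num

theorem exists_orth {m k : ℕ} (h : k < m) (C : Fin k → Fin m → ℝ) :
    ∃ u : Fin m → ℝ, u ⬝ᵥ u ≠ 0 ∧ ∀ i, u ⬝ᵥ C i = 0 := by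
  have : LinearMap.ker (Matrix.mulVecLin (Matrix.of C)) ≠ ⊥ :=
    LinearMap.ker_ne_bot_of_finrank_lt (by simpa using h)
  obtain ⟨u, hu, hne⟩ := Submodule.exists_mem_ne_zero_of_ne_bot this
  refine ⟨u, by simpa using hne, fun i => ?_⟩
  have := congrFun (LinearMap.mem_ker.mp hu) i
  rw [dotProduct_comm]
  simpa [Matrix.mulVec] using this

noncomputable def cst {m : ℕ} (x : Fin m → ℝ) : Fin m → ℂ := fun l => (x l : ℂ)

theorem ev_soAct {m k : ℕ} (P : Pscal m k) (g : Matrix (Fin m) (Fin m) ℝ)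
    (C : Fin k → Fin m → ℝ) :
    ev (soAct m k g P) (fun i => cst (C i)) =
      ev P (fun i => cst (g.transpose.mulVec (C i))) := by
  simp only [ev, soAct, MvPolynomial.aeval_def, MvPolynomial.algebraMap_eq]
  rw [← MvPolynomial.coe_eval₂Hom, MvPolynomial.map_eval₂Hom]
  rw [MvPolynomial.eval, MvPolynomial.coe_eval₂Hom, MvPolynomial.coe_eval₂Hom]
  congr 1
  · ext <;> simp
  · ext p
    simp [cst, Matrix.mulVec, dotProduct]

theorem real_inv {m k : ℕ} (h : k < m) (P : Pscal m k)
    (hP : ∀ g : Matrix (Fin m) (Fin m) ℝ, g.transpose * g = 1 → g.det = 1 → soAct m k g P = P)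
    (v : Fin m → ℝ) (hv : v ⬝ᵥ v ≠ 0) (C : Fin k → Fin m → ℝ) :
    ev P (fun i => cst (rf v (C i))) = ev P (fun i => cst (C i)) := by
  obtain ⟨u, hu, hC⟩ := exists_orth h C
  have h1 := hP (rmat u * rmat v) (by
    rw [Matrix.transpose_mul, rmat_transpose, rmat_transpose, mul_assoc,
      ← mul_assoc (rmat u), rmat_sq u hu, one_mul, rmat_sq v hv]) (by
    rw [Matrix.det_mul, rmat_det u hu, rmat_det v hv]; norm_num)
  have h2 := ev_soAct P (rmat u * rmat v) C
  rw [h1, Matrix.transpose_mul, rmat_transpose, rmat_transpose] at h2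
  rw [h2]
  congr 1
  ext i : 1
  rw [← Matrix.mulVec_mulVec, rmat_mul, rmat_mul]
  congr 2
  simp [rf, hC]

theorem cplx_inv {m k : ℕ} (h : k < m) (P : Pscal m k)
    (hP : ∀ g : Matrix (Fin m) (Fin m) ℝ, g.transpose * g = 1 → g.det = 1 → soAct m k g P = P)
    (v : Fin m → ℂ) (hv : v ⬝ᵥ v ≠ 0) (C : Fin k → Fin m → ℂ) :
    ev P (fun i => rf v (C i)) = ev P C := by
  -- polynomial identity
  let N : MvPolynomial (Fin m ⊕ (Fin m × Fin k)) ℂ :=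
    ∑ l, MvPolynomial.X (Sum.inl l) * MvPolynomial.X (Sum.inl l)
  let A : MvPolynomial (Fin m ⊕ (Fin m × Fin k)) ℂ :=
    MvPolynomial.aeval (fun p : Fin m × Fin k =>
      N * MvPolynomial.X (Sum.inr p) - 2 * (∑ l, MvPolynomial.X (Sum.inl l) *
        MvPolynomial.X (Sum.inr (l, p.2))) * MvPolynomial.X (Sum.inl p.1)) P
  let B : MvPolynomial (Fin m ⊕ (Fin m × Fin k)) ℂ :=
    MvPolynomial.aeval (fun p : Fin m × Fin k => N * MvPolynomial.X (Sum.inr p)) P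
  have hA : ∀ y, MvPolynomial.eval y A = ev P (fun i =>
      ((fun l => y (Sum.inl l)) ⬝ᵥ (fun l => y (Sum.inl l))) • (fun l => y (Sum.inr (l, i)))
       - (2 * ((fun l => y (Sum.inl l)) ⬝ᵥ (fun l => y (Sum.inr (l, i))))) •
        (fun l => y (Sum.inl l))) := by
    intro y
    simp only [A, ev, MvPolynomial.aeval_def, MvPolynomial.algebraMap_eq]
    rw [← MvPolynomial.coe_eval₂Hom, MvPolynomial.map_eval₂Hom, MvPolynomial.eval,
      MvPolynomial.coe_eval₂Hom, MvPolynomial.coe_eval₂Hom]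
    congr 1
    · ext <;> simp
    · ext p
      simp [N, dotProduct]
  have hB : ∀ y, MvPolynomial.eval y B = ev P (fun i =>
      ((fun l => y (Sum.inl l)) ⬝ᵥ (fun l => y (Sum.inl l))) • (fun l => y (Sum.inr (l, i)))) := by
    intro y
    simp only [B, ev, MvPolynomial.aeval_def, MvPolynomial.algebraMap_eq]
    rw [← MvPolynomial.coe_eval₂Hom, MvPolynomial.map_eval₂Hom, MvPolynomial.eval,
      MvPolynomial.coe_eval₂Hom, MvPolynomial.coe_eval₂Hom]
    congr 1
    · ext <;> simp
    · ext p
      simp [N, dotProduct]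
  have hAB : A = B := by
    refine MvPolynomial.funext_set (fun _ => Set.range (fun x : ℝ => (x : ℂ)))
      (fun _ => Set.infinite_range_of_injective Complex.ofReal_injective) ?_
    intro y hy
    have hy' : ∀ i, ∃ x : ℝ, (x : ℂ) = y i := fun i => hy i (Set.mem_univ i)
    choose z hz using hy'
    obtain rfl : (fun i => (z i : ℂ)) = y := funext hz
    rw [hA, hB]
    set a : Fin m → ℝ := fun l => z (Sum.inl l) with ha
    by_cases h0 : a ⬝ᵥ a = 0
    · have : a = 0 := by simpa using h0
      have h1 : ∀ l, z (Sum.inl l) = 0 := fun l => congrFun this l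
      simp [h1]
    · have := real_inv h P hP a h0 (fun i => (a ⬝ᵥ a) • fun l => z (Sum.inr (l, i)))
      simp only [rf_smul_self a _ h0] at this
      convert this using 2
      · ext i l
        simp [cst, dotProduct, a]
      · ext i l
        simp [cst, dotProduct, a]
  have h1 := hA (Sum.elim v (fun p => (v ⬝ᵥ v)⁻¹ * C p.2 p.1))
  have h2 := hB (Sum.elim v (fun p => (v ⬝ᵥ v)⁻¹ * C p.2 p.1))
  rw [hAB, h2] at h1
  have h3 : ∀ i, C i = (v ⬝ᵥ v) • (fun l => (v ⬝ᵥ v)⁻¹ * C i l) := by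
    intro i; ext l; simp [hv]
  convert h1.symm using 2
  · ext i : 1
    conv_lhs => rw [h3 i, rf_smul_self _ _ hv]
    rfl
  · ext i l
    simp [hv]

theorem exists_sep {m : ℕ} (U : Submodule ℂ (Fin m → ℂ)) (x : Fin m → ℂ) (hx : x ∉ U) :
    ∃ u : Fin m → ℂ, (∀ y ∈ U, u ⬝ᵥ y = 0) ∧ u ⬝ᵥ x ≠ 0 := by
  obtain ⟨f, hf, hU⟩ := Submodule.exists_le_ker_of_notMem hx
  have hfe : ∀ y, (fun l => f (Pi.single l 1)) ⬝ᵥ y = f y := by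
    intro y
    conv_rhs => rw [← Finset.univ_sum_single y]
    rw [map_sum, dotProduct]
    refine Finset.sum_congr rfl fun l _ => ?_
    have : (Pi.single l (y l) : Fin m → ℂ) = y l • Pi.single l 1 := by
      rw [← Pi.single_smul]; simp
    simp [this, mul_comm]
  exact ⟨_, fun y hy => by rw [hfe]; exact hU hy, by rwa [hfe]⟩

theorem exists_aniso {m k : ℕ} (X : Fin k → Fin m → ℂ) (s : Finset (Fin k))
    (hs : 2 * s.card < m) : ∃ u : Fin m → ℂ, (∀ i ∈ s, u ⬝ᵥ X i = 0) ∧ u ⬝ᵥ u ≠ 0 := by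
  classical
  by_contra! hcon
  let f : (Fin m → ℂ) →ₗ[ℂ] (s → ℂ) := Matrix.mulVecLin (Matrix.of fun i : s => X i)
  have hW : ∀ u, u ∈ LinearMap.ker f ↔ ∀ i ∈ s, u ⬝ᵥ X i = 0 := by
    intro u
    rw [LinearMap.mem_ker]
    constructor
    · intro h i hi
      have := congrFun h ⟨i, hi⟩
      rw [dotProduct_comm]
      simpa [f, Matrix.mulVec] using this
    · intro h
      ext i
      have := h i i.2
      rw [dotProduct_comm] at this
      simpa [f, Matrix.mulVec] using this
  let U := Submodule.span ℂ ((s.image X : Finset (Fin m → ℂ)) : Set (Fin m → ℂ))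
  have hUW : ∀ u, (∀ y ∈ U, u ⬝ᵥ y = 0) → u ∈ LinearMap.ker f := by
    intro u hu
    rw [hW]
    intro i hi
    exact hu _ (Submodule.subset_span (by simpa using ⟨i, hi, rfl⟩))
  have hle : LinearMap.ker f ≤ U := by
    intro w hw
    by_contra hwU
    obtain ⟨u, hu, huw⟩ := exists_sep U w hwU
    have hu' := hUW u hu
    have h1 := hcon u ((hW u).1 hu')
    have h2 := hcon w ((hW w).1 hw)
    have h3 := hcon (u + w) ((hW _).1 (add_mem hu' hw))
    rw [add_dotProduct, dotProduct_add, dotProduct_add, h1, h2, dotProduct_comm w u] at h3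
    apply huw
    linear_combination h3 / 2
  have h1 := Submodule.finrank_mono hle
  have h2 : Module.finrank ℂ U ≤ s.card :=
    (finrank_span_finset_le_card (R := ℂ) (s.image X)).trans Finset.card_image_le
  have h3 := LinearMap.finrank_range_add_finrank_ker f
  have h4 := Submodule.finrank_le (LinearMap.range f)
  simp at h3 h4
  omega

theorem push {m : ℕ} (u a x : Fin m → ℂ) (hu : u ⬝ᵥ u ≠ 0) (ha : a ⬝ᵥ x ≠ 0) :
    ∀ᶠ t : ℂ in nhdsWithin 0 {0}ᶜ, (u + t • a) ⬝ᵥ (u + t • a) ≠ 0 ∧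
      (u + t • a) ⬝ᵥ x ≠ 0 := by
  have hc : Continuous fun t : ℂ => (u + t • a) ⬝ᵥ (u + t • a) := by
    simp only [dotProduct, Pi.add_apply, Pi.smul_apply, smul_eq_mul]
    fun_prop
  have h1 : ∀ᶠ t : ℂ in nhdsWithin 0 {0}ᶜ, (u + t • a) ⬝ᵥ (u + t • a) ≠ 0 :=
    (hc.continuousAt.eventually_ne (by simpa using hu)).filter_mono nhdsWithin_le_nhds
  refine h1.and ?_
  by_cases h0 : u ⬝ᵥ x = 0
  · filter_upwards [self_mem_nhdsWithin] with t ht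
    have : t ≠ 0 := ht
    simp [h0, this, ha]
  · have hc : Continuous fun t : ℂ => (u + t • a) ⬝ᵥ x := by
      simp only [dotProduct, Pi.add_apply, Pi.smul_apply, smul_eq_mul]
      fun_prop
    exact (hc.continuousAt.eventually_ne (by simpa using h0)).filter_mono nhdsWithin_le_nhds

theorem exists_u {m k : ℕ} (X : Fin k → Fin m → ℂ) (s : Finset (Fin k))
    (hs : 2 * s.card < m) (x y : Fin m → ℂ)
    (hx : x ∉ Submodule.span ℂ (X '' s)) (hy : y ∉ Submodule.span ℂ (X '' s)) :
    ∃ u : Fin m → ℂ, (∀ i ∈ s, u ⬝ᵥ X i = 0) ∧ u ⬝ᵥ u ≠ 0 ∧ u ⬝ᵥ x ≠ 0 ∧ u ⬝ᵥ y ≠ 0 := by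
  obtain ⟨u, hu, huu⟩ := exists_aniso X s hs
  obtain ⟨a, ha, hax⟩ := exists_sep _ x hx
  obtain ⟨b, hb, hby⟩ := exists_sep _ y hy
  have ha' : ∀ i ∈ s, a ⬝ᵥ X i = 0 := fun i hi =>
    ha _ (Submodule.subset_span ⟨i, hi, rfl⟩)
  have hb' : ∀ i ∈ s, b ⬝ᵥ X i = 0 := fun i hi =>
    hb _ (Submodule.subset_span ⟨i, hi, rfl⟩)
  obtain ⟨t, ht1, ht2⟩ := (push u a x huu hax).exists
  have hc : Continuous fun r : ℂ => ((u + t • a) + r • b) ⬝ᵥ x := by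
    simp only [dotProduct, Pi.add_apply, Pi.smul_apply, smul_eq_mul]
    fun_prop
  have h3 : ∀ᶠ r : ℂ in nhdsWithin 0 {0}ᶜ, ((u + t • a) + r • b) ⬝ᵥ x ≠ 0 :=
    (hc.continuousAt.eventually_ne (by simpa using ht2)).filter_mono nhdsWithin_le_nhds
  obtain ⟨r, ⟨hr1, hr2⟩, hr3⟩ := ((push (u + t • a) b y ht1 hby).and h3).exists
  refine ⟨_, fun i hi => ?_, hr1, hr3, hr2⟩
  simp [hu i hi, ha' i hi, hb' i hi]

noncomputable def rfl' {m : ℕ} (v : Fin m → ℂ) : (Fin m → ℂ) →ₗ[ℂ] (Fin m → ℂ) where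
  toFun := rf v
  map_add' x y := by
    ext l; simp [rf]; ring
  map_smul' c x := by
    ext l; simp [rf]; ring

theorem rf_rf {m : ℕ} (v x : Fin m → ℂ) (hv : v ⬝ᵥ v ≠ 0) : rf v (rf v x) = x := by
  ext l
  simp [rf]
  field_simp
  ring

theorem rf_dot {m : ℕ} (v x y : Fin m → ℂ) (hv : v ⬝ᵥ v ≠ 0) :
    rf v x ⬝ᵥ rf v y = x ⬝ᵥ y := by
  simp only [rf, sub_dotProduct, dotProduct_sub, smul_dotProduct, dotProduct_smul, smul_eq_mul]
  rw [dotProduct_comm x v]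
  field_simp
  ring

theorem rf_li {m k : ℕ} (v : Fin m → ℂ) (hv : v ⬝ᵥ v ≠ 0) (X : Fin k → Fin m → ℂ)
    (hX : LinearIndependent ℂ X) : LinearIndependent ℂ (fun i => rf v (X i)) := by
  apply LinearIndependent.of_comp (rfl' v)
  convert hX using 1
  ext1 i
  exact rf_rf v (X i) hv

theorem rf_fix {m : ℕ} (v x : Fin m → ℂ) (h : v ⬝ᵥ x = 0) : rf v x = x := by
  simp [rf, h]

theorem witt {m k : ℕ} (hmk : 2 * k ≤ m) (P : Pscal m k)
    (H : ∀ v : Fin m → ℂ, v ⬝ᵥ v ≠ 0 → ∀ C : Fin k → Fin m → ℂ,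
      ev P (fun i => rf v (C i)) = ev P C)
    (Y : Fin k → Fin m → ℂ) (hY : LinearIndependent ℂ Y) (n : ℕ) :
    ∀ s : Finset (Fin k), (sᶜ).card = n → ∀ X : Fin k → Fin m → ℂ, LinearIndependent ℂ X →
      (∀ i j, X i ⬝ᵥ X j = Y i ⬝ᵥ Y j) → (∀ i ∈ s, X i = Y i) → ev P X = ev P Y := by
  induction n with
  | zero =>
    intro s hs X _ _ hag
    have : s = Finset.univ := by simpa using hs
    subst this
    congr 1
    ext1 i
    exact hag i (Finset.mem_univ i)
  | succ n ih =>
    intro s hs X hX hG hag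
    obtain ⟨j, hj⟩ : (sᶜ).Nonempty := by rw [← Finset.card_pos]; omega
    have hjs : j ∉ s := by simpa using hj
    have hscard : 2 * s.card < m := by
      have := Finset.card_compl_add_card s
      rw [Fintype.card_fin] at this
      omega
    -- one reflection
    have one : ∀ X : Fin k → Fin m → ℂ, LinearIndependent ℂ X →
        (∀ i j, X i ⬝ᵥ X j = Y i ⬝ᵥ Y j) → (∀ i ∈ s, X i = Y i) →
        (X j - Y j) ⬝ᵥ (X j - Y j) ≠ 0 → ev P X = ev P Y := by
      intro X hX hG hag hd
      rw [← H _ hd X]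
      apply ih (insert j s)
      · rw [Finset.compl_insert, Finset.card_erase_of_mem hj]; omega
      · exact rf_li _ hd X hX
      · intro i i'
        rw [rf_dot _ _ _ hd, hG]
      · intro i hi
        rcases Finset.mem_insert.1 hi with rfl | hi
        · have h1 : (X i - Y i) ⬝ᵥ (X i - Y i) = 2 * ((X i - Y i) ⬝ᵥ X i) := by
            have := hG i i
            simp only [sub_dotProduct, dotProduct_sub]
            rw [dotProduct_comm (Y i) (X i)]
            linear_combination -this
          rw [rf, ← h1, div_self hd, one_smul, sub_sub_cancel]
        · rw [rf_fix, hag i hi]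
          have := hG j i
          rw [sub_dotProduct, this, hag i hi, sub_self]
    by_cases hd : (X j - Y j) ⬝ᵥ (X j - Y j) = 0
    · have hspan : X '' s = Y '' s := Set.image_congr (fun i hi => hag i hi)
      obtain ⟨u, hus, huu, hux, huy⟩ := exists_u X s hscard (X j) (Y j)
        (hX.notMem_span_image (by simpa using hjs))
        (by rw [hspan]; exact hY.notMem_span_image (by simpa using hjs))
      rw [← H u huu X]
      apply one
      · exact rf_li _ huu X hX
      · intro i i'
        rw [rf_dot _ _ _ huu, hG]
      · intro i hi
        rw [rf_fix _ _ (hus i hi), hag i hi]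
      · have h1 : (rf u (X j) - Y j) ⬝ᵥ (rf u (X j) - Y j) =
            (X j - Y j) ⬝ᵥ (X j - Y j) + 4 * (u ⬝ᵥ X j) * (u ⬝ᵥ Y j) / (u ⬝ᵥ u) := by
          simp only [rf, sub_dotProduct, dotProduct_sub, smul_dotProduct, dotProduct_smul,
            smul_eq_mul]
          rw [dotProduct_comm (X j) u, dotProduct_comm (Y j) u, dotProduct_comm (Y j) (X j)]
          field_simp
          ring
        rw [h1, hd, zero_add]
        exact div_ne_zero (mul_ne_zero (mul_ne_zero (by norm_num) hux) huy) huu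
    · exact one X hX hG hag hd

/-- the section: columns -/
noncomputable def sect (k n : ℕ) {R : Type*} [CommRing R] [Algebra ℂ R]
    (S : Fin k → Fin k → R) (j : Fin k) : Fin (k + k + n) → R :=
  Fin.append (Fin.append
    (fun l => (if l = j then 1 else 0) + algebraMap ℂ R (1/4) * S l j)
    (fun l => algebraMap ℂ R Complex.I *
      ((if l = j then 1 else 0) - algebraMap ℂ R (1/4) * S l j))) (fun _ => 0)

theorem sect_gram (k n : ℕ) (S : Fin k → Fin k → ℂ) (hS : ∀ i j, S i j = S j i) (i j : Fin k) :
    sect k n S i ⬝ᵥ sect k n S j = S i j := by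
  have : ∀ l, ((if l = i then 1 else 0) + (1/4) * S l i) * ((if l = j then 1 else 0) + (1/4) * S l j)
      + (Complex.I * ((if l = i then 1 else 0) - (1/4) * S l i)) *
       (Complex.I * ((if l = j then 1 else 0) - (1/4) * S l j)) =
      (if l = i then 1 / 2 * S l j else 0) + (if l = j then 1 / 2 * S l i else 0) := by
    intro l
    have hI := Complex.I_sq
    split_ifs <;> ring_nf <;> simp only [hI] <;> ring
  simp only [dotProduct, Fin.sum_univ_add, sect, Fin.append_left, Fin.append_right, mul_zero,
    Finset.sum_const_zero, add_zero, ← Finset.sum_add_distrib, Algebra.algebraMap_self,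
    RingHom.id_apply, this]
  rw [Finset.sum_add_distrib]
  simp only [Finset.sum_ite_eq', Finset.mem_univ, if_true]
  rw [hS j i]
  ring

theorem sect_li (k n : ℕ) (S : Fin k → Fin k → ℂ) : LinearIndependent ℂ (sect k n S) := by
  let f : (Fin (k + k + n) → ℂ) →ₗ[ℂ] (Fin k → ℂ) :=
    LinearMap.pi fun l => LinearMap.proj (Fin.castAdd n (Fin.castAdd k l)) -
      Complex.I • LinearMap.proj (Fin.castAdd n (Fin.natAdd k l))
  apply LinearIndependent.of_comp f
  have : f ∘ sect k n S = fun j => (2 : ℂ) • (Pi.single j 1 : Fin k → ℂ) := by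
    ext j l
    simp [f, sect, Pi.single_apply, -Fin.natAdd_eq_addNat]
    rw [← mul_assoc, Complex.I_mul_I]
    split_ifs <;> ring
  rw [this]
  rw [Fintype.linearIndependent_iff]
  intro g hg i
  have := congrFun hg i
  simpa [Finset.sum_apply, Pi.single_apply] using this

theorem top_li (k n : ℕ) (X : Fin k → Fin (k + k + n) → ℂ)
    (h : (Matrix.of fun i l : Fin k => X i (Fin.castAdd n (Fin.castAdd k l))).det ≠ 0) :
    LinearIndependent ℂ X := by
  apply LinearIndependent.of_comp
    (LinearMap.funLeft ℂ ℂ (fun l : Fin k => Fin.castAdd n (Fin.castAdd k l)))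
  exact Matrix.linearIndependent_rows_of_det_ne_zero h

theorem hard_dir (k n : ℕ) (hk : 1 ≤ k) (P : Pscal (k + k + n) k)
    (hP : ∀ g : Matrix (Fin (k + k + n)) (Fin (k + k + n)) ℝ,
      g.transpose * g = 1 → g.det = 1 → soAct (k + k + n) k g P = P) :
    P ∈ Algebra.adjoin ℂ
      {q : Pscal (k + k + n) k | ∃ i j : Fin k, i ≤ j ∧ q = rP (k + k + n) k i j} := by
  set 𝒜 := Algebra.adjoin ℂ
      {q : Pscal (k + k + n) k | ∃ i j : Fin k, i ≤ j ∧ q = rP (k + k + n) k i j} with h𝒜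
  let Q : Pscal (k + k + n) k :=
    MvPolynomial.aeval (fun p => sect k n (rP (k + k + n) k) p.2 p.1) P
  have hr : ∀ i j, rP (k + k + n) k i j ∈ 𝒜 := by
    intro i j
    rcases le_total i j with h | h
    · exact Algebra.subset_adjoin ⟨i, j, h, rfl⟩
    · refine Algebra.subset_adjoin ⟨j, i, h, ?_⟩
      simp only [rP, mul_comm]
  have hs : ∀ j l, sect k n (rP (k + k + n) k) j l ∈ 𝒜 := by
    intro j l
    have hite : ∀ a b : Fin k, (if a = b then 1 else 0 : Pscal (k + k + n) k) ∈ 𝒜 := by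
      intro a b; split_ifs
      · exact one_mem _
      · exact zero_mem _
    refine Fin.addCases (fun l => ?_) (fun l => ?_) l
    · refine Fin.addCases (fun l => ?_) (fun l => ?_) l
      · simp only [sect, Fin.append_left]
        exact add_mem (hite _ _) (mul_mem (algebraMap_mem _ _) (hr _ _))
      · simp only [sect, Fin.append_left, Fin.append_right]
        exact mul_mem (algebraMap_mem _ _)
          (sub_mem (hite _ _) (mul_mem (algebraMap_mem _ _) (hr _ _)))
    · simp only [sect, Fin.append_right]
      exact zero_mem _
  have hQ : Q ∈ 𝒜 := by
    have : Q = 𝒜.val (MvPolynomial.aeval (fun p : Fin (k + k + n) × Fin k =>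
        (⟨_, hs p.2 p.1⟩ : 𝒜)) P) := by
      rw [MvPolynomial.comp_aeval_apply]
      rfl
    rw [this]
    exact Subtype.prop _
  have hevQ : ∀ X : Fin k → Fin (k + k + n) → ℂ,
      ev Q X = ev P (sect k n (fun i j => X i ⬝ᵥ X j)) := by
    intro X
    simp only [Q, ev, MvPolynomial.aeval_def, MvPolynomial.algebraMap_eq]
    rw [← MvPolynomial.coe_eval₂Hom, MvPolynomial.map_eval₂Hom, MvPolynomial.eval,
      MvPolynomial.coe_eval₂Hom, MvPolynomial.coe_eval₂Hom]
    congr 1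
    · ext; simp
    · ext ⟨l, j⟩
      have hrr : ∀ i j, MvPolynomial.eval
          (fun p : Fin (k + k + n) × Fin k => X p.2 p.1) (rP (k + k + n) k i j) = X i ⬝ᵥ X j := by
        intro i j
        simp [rP, dotProduct]
      refine Fin.addCases (fun l => ?_) (fun l => ?_) l
      · refine Fin.addCases (fun l => ?_) (fun l => ?_) l
        · simp only [sect, Fin.append_left, MvPolynomial.algebraMap_eq]
          split_ifs <;> simp [hrr]
        · simp only [sect, Fin.append_left, Fin.append_right, MvPolynomial.algebraMap_eq]
          split_ifs <;> simp [hrr]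
      · simp [sect]
  let δ : Pscal (k + k + n) k :=
    (Matrix.of fun i l : Fin k => (MvPolynomial.X (Fin.castAdd n (Fin.castAdd k l), i) :
      Pscal (k + k + n) k)).det
  have hδ : ∀ X : Fin k → Fin (k + k + n) → ℂ, ev δ X =
      (Matrix.of fun i l : Fin k => X i (Fin.castAdd n (Fin.castAdd k l))).det := by
    intro X
    simp only [δ, ev, RingHom.map_det]
    congr 1
    ext i l
    simp
  have hδ0 : δ ≠ 0 := by
    intro h0
    have h1 := hδ (sect k n (fun _ _ => 0))
    rw [h0] at h1
    have h2 : (Matrix.of fun i l : Fin k => sect k n (fun _ _ => (0 : ℂ)) i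
        (Fin.castAdd n (Fin.castAdd k l))) = 1 := by
      ext i l
      simp [sect, Matrix.one_apply, eq_comm]
    rw [h2] at h1
    simp [ev] at h1
  have hinv := cplx_inv (by omega) P hP
  have hmain : δ * (P - Q) = 0 := by
    apply MvPolynomial.funext
    intro x
    let X : Fin k → Fin (k + k + n) → ℂ := fun i l => x (l, i)
    have hx : ∀ R : Pscal (k + k + n) k, MvPolynomial.eval x R = ev R X := fun R => rfl
    rw [map_mul, map_sub, map_zero, hx, hx, hx]
    by_cases h0 : ev δ X = 0
    · rw [h0, zero_mul]
    · rw [hevQ, witt (by omega) P hinv (sect k n (fun i j => X i ⬝ᵥ X j)) (sect_li _ _ _) _ ∅ rfl X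
        (top_li k n X (by rwa [← hδ])), sub_self, mul_zero]
      · intro i j
        rw [sect_gram]
        intro i j
        exact dotProduct_comm _ _
      · simp
  have : P = Q := sub_eq_zero.1 ((mul_eq_zero.1 hmain).resolve_left hδ0)
  rw [this]
  exact hQ


/-- First fundamental theorem of invariants in the stable range (Theorem 3.1(i), first part):
a polynomial is SO(m)-invariant iff it belongs to the unital subalgebra generated by the
quadratic invariants r²_ij, 1 ≤ i ≤ j ≤ k. -/
theorem invariants_eq_adjoin_r (m k : ℕ) (hm : 1 ≤ m) (hk : 1 ≤ k)
    (hrange : 2 * k ≤ m) (P : Pscal m k) :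
    (∀ g : Matrix (Fin m) (Fin m) ℝ, g.transpose * g = 1 → g.det = 1 → soAct m k g P = P) ↔
      P ∈ Algebra.adjoin ℂ {q : Pscal m k | ∃ i j : Fin k, i ≤ j ∧ q = rP m k i j} := by
  constructor
  · intro hP
    obtain ⟨n, rfl⟩ : ∃ n, m = k + k + n := ⟨m - 2 * k, by omega⟩
    exact hard_dir k n hk P hP
  · intro h g hg _
    exact easy_dir m k P h g hg
end

section
/- Separation of variables in the stable range (Theorem 3.1(ii)). Assume m ≥ 2k. Let I denote the unital ℂ-subalgebra of P generated by the polynomials r²_ij, 1 ≤ i ≤ j ≤ k (the algebra of SO(m)-invariants). Then the ℂ-linear map I ⊗_ℂ H → P induced by multiplication of polynomials, I ⊗ H ↦ I·H, is a linear isomorphism. -/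
open scoped TensorProduct

namespace SepVar
open MvPolynomial Pointwise

noncomputable section

section Fischer
variable {σ : Type*}

def fc (a : σ →₀ ℕ) : ℝ := a.prod fun _ e => (Nat.factorial e : ℝ)

theorem fc_pos (a : σ →₀ ℕ) : 0 < fc a := by
  unfold fc Finsupp.prod
  exact Finset.prod_pos fun i _ => Nat.cast_pos.2 (Nat.factorial_pos _)

theorem fc_add_single (a : σ →₀ ℕ) (i : σ) :
    fc (a + Finsupp.single i 1) = (a i + 1) * fc a := by
  classical
  have h1 : ∀ b : σ →₀ ℕ, b.support ⊆ insert i a.support →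
      fc b = ∏ j ∈ insert i a.support, (Nat.factorial (b j) : ℝ) := fun b hb =>
    Finsupp.prod_of_support_subset _ hb _ (by simp)
  rw [h1 a (Finset.subset_insert _ _), h1 (a + Finsupp.single i 1)]
  · rw [← Finset.mul_prod_erase _ _ (Finset.mem_insert_self i _),
      ← Finset.mul_prod_erase _ (fun j => (Nat.factorial (a j) : ℝ)) (Finset.mem_insert_self i _),
      ← mul_assoc]
    congr 1
    · simp [Nat.factorial_succ]
    · refine Finset.prod_congr rfl fun j hj => ?_
      simp [Finsupp.single_eq_of_ne (Finset.ne_of_mem_erase hj)]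
  · intro j hj
    by_cases h : j = i
    · simp [h]
    · simp [Finsupp.single_eq_of_ne h] at hj ⊢
      exact Or.inr hj

def B (f g : MvPolynomial σ ℂ) : ℂ :=
  ∑ a ∈ f.support, (fc a : ℂ) * (starRingEnd ℂ) (f.coeff a) * g.coeff a

theorem B_eq (f g : MvPolynomial σ ℂ) (s : Finset (σ →₀ ℕ)) (hs : f.support ⊆ s) :
    B f g = ∑ a ∈ s, (fc a : ℂ) * (starRingEnd ℂ) (f.coeff a) * g.coeff a := by
  refine Finset.sum_subset hs fun a _ ha => ?_
  rw [notMem_support_iff.1 ha]; simp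

theorem B_add (f f' g : MvPolynomial σ ℂ) : B (f + f') g = B f g + B f' g := by
  classical
  rw [B_eq (f + f') g (f.support ∪ f'.support) support_add,
    B_eq f g _ Finset.subset_union_left, B_eq f' g (f.support ∪ f'.support) Finset.subset_union_right,
    ← Finset.sum_add_distrib]
  refine Finset.sum_congr rfl fun a _ => ?_
  simp; ring

theorem B_zero_left (g : MvPolynomial σ ℂ) : B 0 g = 0 := by simp [B]
theorem B_zero_right (g : MvPolynomial σ ℂ) : B g 0 = 0 := by simp [B]

theorem B_add_right (f g g' : MvPolynomial σ ℂ) : B f (g + g') = B f g + B f g' := by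
  simp [B, mul_add, Finset.sum_add_distrib]

theorem B_sum {ι : Type*} (s : Finset ι) (f : ι → MvPolynomial σ ℂ) (g : MvPolynomial σ ℂ) :
    B (∑ i ∈ s, f i) g = ∑ i ∈ s, B (f i) g := by
  classical
  induction s using Finset.induction_on with
  | empty => simp [B_zero_left]
  | insert a s ha ih => rw [Finset.sum_insert ha, Finset.sum_insert ha, B_add, ih]

theorem B_sum_right {ι : Type*} (s : Finset ι) (f : MvPolynomial σ ℂ) (g : ι → MvPolynomial σ ℂ) :
    B f (∑ i ∈ s, g i) = ∑ i ∈ s, B f (g i) := by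
  classical
  induction s using Finset.induction_on with
  | empty => simp [B_zero_right]
  | insert a s ha ih => rw [Finset.sum_insert ha, Finset.sum_insert ha, B_add_right, ih]

theorem B_X_mul (i : σ) (f g : MvPolynomial σ ℂ) : B (X i * f) g = B f (pderiv i g) := by
  classical
  induction f using MvPolynomial.induction_on' with
  | monomial a c =>
    have h : (X i * monomial a c : MvPolynomial σ ℂ) = monomial (a + Finsupp.single i 1) c := by
      rw [X, monomial_mul, one_mul, add_comm]
    rw [h, B_eq _ _ _ support_monomial_subset, B_eq (monomial a c) _ _ support_monomial_subset]
    simp [coeff_pderiv, fc_add_single]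
    ring
  | add p q hp hq => rw [mul_add, B_add, B_add, hp, hq]

theorem B_self_re (f : MvPolynomial σ ℂ) :
    B f f = ((∑ a ∈ f.support, fc a * Complex.normSq (f.coeff a) : ℝ) : ℂ) := by
  unfold B
  push_cast
  refine Finset.sum_congr rfl fun a _ => ?_
  rw [mul_assoc, Complex.normSq_eq_conj_mul_self]

theorem B_self_nonneg (f : MvPolynomial σ ℂ) : 0 ≤ (B f f).re := by
  rw [B_self_re, Complex.ofReal_re]
  exact Finset.sum_nonneg fun a _ => mul_nonneg (fc_pos a).le (Complex.normSq_nonneg _)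

theorem eq_zero_of_B (f : MvPolynomial σ ℂ) (h : (B f f).re = 0) : f = 0 := by
  rw [B_self_re, Complex.ofReal_re, Finset.sum_eq_zero_iff_of_nonneg
    fun a _ => mul_nonneg (fc_pos a).le (Complex.normSq_nonneg _)] at h
  ext a
  by_contra hne
  have := h a (mem_support_iff.2 hne)
  rcases mul_eq_zero.1 this with h | h
  · exact (fc_pos a).ne' h
  · exact hne (Complex.normSq_eq_zero.1 h)

end Fischer

section Deg
variable {σ : Type*}

def D (σ : Type*) (n : ℕ) : Submodule ℂ (MvPolynomial σ ℂ) :=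
  restrictSupport ℂ {a : σ →₀ ℕ | a.degree < n}

theorem mem_D {n : ℕ} {f : MvPolynomial σ ℂ} :
    f ∈ D σ n ↔ ∀ a, f.coeff a ≠ 0 → a.degree < n := by
  rw [D, mem_restrictSupport_iff]
  simp [Set.subset_def]

theorem D_zero {f : MvPolynomial σ ℂ} (h : f ∈ D σ 0) : f = 0 := by
  ext a
  by_contra hne
  exact absurd (mem_D.1 h a hne) (by simp)

theorem pderiv_mem_D {n : ℕ} {f : MvPolynomial σ ℂ} (i : σ) (h : f ∈ D σ n) :
    pderiv i f ∈ D σ (n - 1) := by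
  rw [mem_D] at h ⊢
  intro a ha
  rw [coeff_pderiv] at ha
  have := h _ (left_ne_zero_of_mul ha)
  rw [map_add, Finsupp.degree_single] at this
  omega

theorem X_mul_mem_D {n : ℕ} {f : MvPolynomial σ ℂ} (i : σ) (h : f ∈ D σ n) :
    X i * f ∈ D σ (n + 1) := by
  classical
  rw [mem_D] at h ⊢
  intro a ha
  rw [coeff_X_mul'] at ha
  split_ifs at ha with hi
  · have := h _ ha
    have h2 : a - Finsupp.single i 1 + Finsupp.single i 1 = a :=
      tsub_add_cancel_of_le (by simpa [Nat.one_le_iff_ne_zero] using hi)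
    rw [← h2, map_add, Finsupp.degree_single]
    omega
  · exact absurd rfl ha

theorem exists_mem_D (f : MvPolynomial σ ℂ) : ∃ n, f ∈ D σ n := by
  refine ⟨f.support.sup Finsupp.degree + 1, mem_D.2 fun a ha => Nat.lt_succ_of_le ?_⟩
  exact Finset.le_sup (f := Finsupp.degree) (mem_support_iff.2 ha)

instance [Finite σ] (n : ℕ) : Module.Finite ℂ (D σ n) := by
  have : Finite {a : σ →₀ ℕ | a.degree < n} := by
    refine Set.Finite.subset (Finsupp.finite_of_degree_le n) ?_
    intro a ha
    simp only [Set.mem_ofPred_eq] at ha ⊢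
    exact ha.le
  exact Module.Finite.of_basis (basisRestrictSupport ℂ _)

end Deg

section Lead
variable {σ τ : Type*}

def F (w : σ → ℕ) (n : ℕ) : Submodule ℂ (MvPolynomial σ ℂ) :=
  restrictSupport ℂ {a : σ →₀ ℕ | Finsupp.weight w a < n}

theorem lt_of_mem_F {w : σ → ℕ} {n : ℕ} {f : MvPolynomial σ ℂ} (hf : f ∈ F w n) {a : σ →₀ ℕ}
    (ha : f.coeff a ≠ 0) : Finsupp.weight w a < n := by
  have := (mem_restrictSupport_iff ℂ).1 hf (mem_support_iff.2 ha)
  simpa using this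

theorem F_mul {w : σ → ℕ} {n n' : ℕ} {f g : MvPolynomial σ ℂ} (hf : f ∈ F w n) (hg : g ∈ F w n') :
    f * g ∈ F w (n + n') := by
  have h1 : f * g ∈ F w n * F w n' := Submodule.mul_mem_mul hf hg
  unfold F at h1
  rw [← restrictSupport_add] at h1
  refine restrictSupport_mono ℂ ?_ h1
  rintro _ ⟨a, ha, b, hb, rfl⟩
  simp only [Set.mem_ofPred_eq, map_add] at *
  omega

theorem F_mono {w : σ → ℕ} {n n' : ℕ} (h : n ≤ n') : F w n ≤ F w n' :=
  restrictSupport_mono ℂ fun _ ha => lt_of_lt_of_le ha h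

theorem monomial_mem_F {w : σ → ℕ} {n : ℕ} {a : σ →₀ ℕ} (c : ℂ) (h : Finsupp.weight w a < n) :
    monomial a c ∈ F w n := (monomial_mem_restrictSupport ℂ).2 (Or.inl h)

/-- `f` has leading monomial `a` with coefficient one. -/
def Ld (w : σ → ℕ) (f : MvPolynomial σ ℂ) (a : σ →₀ ℕ) : Prop :=
  f - monomial a 1 ∈ F w (Finsupp.weight w a)

theorem F_mul_monomial {w : σ → ℕ} {n : ℕ} {f : MvPolynomial σ ℂ} (hf : f ∈ F w n) (a : σ →₀ ℕ) :
    f * monomial a 1 ∈ F w (n + Finsupp.weight w a) := by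
  have h1 : f * monomial a 1 ∈ restrictSupport ℂ ({a : σ →₀ ℕ | Finsupp.weight w a < n} + ({a} : Set (σ →₀ ℕ))) := by
    rw [restrictSupport_add]
    exact Submodule.mul_mem_mul hf ((monomial_mem_restrictSupport ℂ).2 (Or.inl rfl))
  refine restrictSupport_mono ℂ ?_ h1
  rintro _ ⟨a, ha, b, hb, rfl⟩
  simp only [Set.mem_ofPred_eq, map_add, Set.mem_singleton_iff] at *
  subst hb
  omega

theorem Ld.mul {w : σ → ℕ} {f g : MvPolynomial σ ℂ} {a b : σ →₀ ℕ} (hf : Ld w f a) (hg : Ld w g b) :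
    Ld w (f * g) (a + b) := by
  unfold Ld at *
  have : f * g - monomial (a + b) 1 = (f - monomial a 1) * (g - monomial b 1)
      + (f - monomial a 1) * monomial b 1 + (g - monomial b 1) * monomial a 1 := by
    have : (monomial (a + b) 1 : MvPolynomial σ ℂ) = monomial a 1 * monomial b 1 := by
      rw [monomial_mul, one_mul]
    rw [this]; ring
  rw [this, map_add]
  refine add_mem (add_mem (F_mul hf hg) (F_mul_monomial hf b)) ?_
  rw [add_comm (Finsupp.weight w a)]
  exact F_mul_monomial hg a

theorem Ld.monomial (w : σ → ℕ) (a : σ →₀ ℕ) : Ld w (monomial a 1) a := by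
  simp [Ld]

theorem Ld.pow {w : σ → ℕ} {f : MvPolynomial σ ℂ} {a : σ →₀ ℕ} (hf : Ld w f a) (n : ℕ) :
    Ld w (f ^ n) (n • a) := by
  induction n with
  | zero => simpa using Ld.monomial w 0
  | succ n ih => rw [pow_succ, succ_nsmul]; exact ih.mul hf

theorem Ld.prod {w : σ → ℕ} (s : Finset τ) {f : τ → MvPolynomial σ ℂ} {a : τ → σ →₀ ℕ}
    (hf : ∀ p ∈ s, Ld w (f p) (a p)) : Ld w (∏ p ∈ s, f p) (∑ p ∈ s, a p) := by
  classical
  induction s using Finset.induction_on with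
  | empty => simpa using Ld.monomial w 0
  | insert p s hp ih =>
    rw [Finset.prod_insert hp, Finset.sum_insert hp]
    exact (hf p (by simp)).mul (ih fun q hq => hf q (by simp [hq]))

/-- A linear endomorphism that is unitriangular for the weight filtration is bijective. -/
theorem bij_of_Ld (w : σ → ℕ) (Φ : MvPolynomial σ ℂ →ₗ[ℂ] MvPolynomial σ ℂ)
    (h : ∀ a, Ld w (Φ (MvPolynomial.monomial a 1)) a) : Function.Bijective Φ := by
  classical
  have hm : ∀ (a : σ →₀ ℕ) (c : ℂ), MvPolynomial.monomial a c = c • MvPolynomial.monomial a 1 := by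
    intro a c; rw [smul_monomial, smul_eq_mul, mul_one]
  constructor
  · rw [injective_iff_map_eq_zero]
    intro f hf
    by_contra hne
    obtain ⟨a, ha, hmax⟩ := Finset.exists_max_image f.support (Finsupp.weight w)
      (support_nonempty.2 hne)
    have hsum : ∑ b ∈ f.support, f.coeff b • coeff a (Φ (MvPolynomial.monomial b 1)) = 0 := by
      have := congrArg (fun q => coeff a (Φ q)) f.as_sum
      simp only [hf, coeff_zero, map_sum, coeff_sum] at this
      rw [this]
      refine Finset.sum_congr rfl fun b _ => ?_
      rw [hm b (f.coeff b), map_smul, coeff_smul]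
    rw [Finset.sum_eq_single a] at hsum
    · have h1 : coeff a (Φ (MvPolynomial.monomial a 1) - MvPolynomial.monomial a 1) = 0 := by
        by_contra hc
        exact lt_irrefl _ (lt_of_mem_F (h a) hc)
      rw [coeff_sub, coeff_monomial, if_pos rfl, sub_eq_zero] at h1
      rw [h1] at hsum
      exact mem_support_iff.1 ha (by simpa using hsum)
    · intro b hb hba
      have h1 : coeff a (Φ (MvPolynomial.monomial b 1) - MvPolynomial.monomial b 1) = 0 := by
        by_contra hc
        have h2 : Finsupp.weight w a < Finsupp.weight w b :=
          lt_of_mem_F (h b) hc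
        have := hmax b hb
        omega
      rw [coeff_sub, coeff_monomial, if_neg hba, sub_zero] at h1
      rw [h1, smul_zero]
    · intro h; exact absurd ha h
  · rw [← LinearMap.range_eq_top]
    have key : ∀ n, F w n ≤ LinearMap.range Φ := by
      intro n
      induction n with
      | zero =>
        intro f hf
        have : f = 0 := by
          ext a; by_contra hc
          exact absurd (lt_of_mem_F hf hc) (Nat.not_lt_zero _)
        rw [this]; exact zero_mem _
      | succ n ih =>
        unfold F
        rw [restrictSupport_eq_span, Submodule.span_le]
        rintro _ ⟨a, ha, rfl⟩
        have h1 : Φ (MvPolynomial.monomial a 1) - MvPolynomial.monomial a 1 ∈ LinearMap.range Φ :=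
          ih (F_mono (Nat.lt_succ_iff.1 ha) (h a))
        have := sub_mem (LinearMap.mem_range_self Φ (MvPolynomial.monomial a 1)) h1
        simpa using this
    refine eq_top_iff.2 fun f _ => ?_
    rw [f.as_sum]
    refine sum_mem fun a _ => key (Finsupp.weight w a + 1) (monomial_mem_F _ (Nat.lt_succ_self _))

end Lead

section Free
variable {σ τ : Type*}

/-- Multiplicity of the exponent `u` in the exponent `a`. -/
def al (u a : σ →₀ ℕ) : ℕ := by
  classical exact Nat.findGreatest (fun n => n • u ≤ a) a.degree

theorem le_al {u : σ →₀ ℕ} (hu : u ≠ 0) {a : σ →₀ ℕ} {n : ℕ} : n ≤ al u a ↔ n • u ≤ a := by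
  classical
  constructor
  · intro h
    have : al u a • u ≤ a := by
      have := Nat.findGreatest_spec (P := fun n => n • u ≤ a) (Nat.zero_le a.degree) (by simp)
      convert this
      unfold al; congr
    exact (nsmul_le_nsmul_left zero_le h).trans this
  · intro h
    have hd : n ≤ a.degree := by
      have h1 : (n • u).degree ≤ a.degree := by
        obtain ⟨c, rfl⟩ := exists_add_of_le h
        rw [map_add]; exact Nat.le_add_right _ _
      have h2 : 0 < u.degree := Nat.pos_of_ne_zero (by rwa [Ne, Finsupp.degree_eq_zero_iff])
      rw [map_nsmul, smul_eq_mul] at h1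
      nlinarith
    have := Nat.le_findGreatest (P := fun n => n • u ≤ a) hd h
    convert this
    unfold al; congr

variable [Fintype τ] (e : τ → σ →₀ ℕ)

def E (c : τ → ℕ) : σ →₀ ℕ := ∑ p, c p • e p

variable {e}

theorem E_apply (hd : ∀ p q x, e p x ≠ 0 → e q x ≠ 0 → p = q) (c : τ → ℕ) (p : τ) (x : σ)
    (hx : e p x ≠ 0) : E e c x = c p * e p x := by
  rw [E, Finsupp.finsetSum_apply, Finset.sum_eq_single p]
  · simp
  · intro q _ hq
    have : e q x = 0 := by
      by_contra h
      exact hq (hd q p x h hx)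
    simp [this]
  · simp

theorem E_le (he : ∀ p, e p ≠ 0) (hd : ∀ p q x, e p x ≠ 0 → e q x ≠ 0 → p = q)
    (c : τ → ℕ) (a : σ →₀ ℕ) : E e c ≤ a ↔ ∀ p, c p ≤ al (e p) a := by
  constructor
  · intro h p
    rw [le_al (he p)]
    refine le_trans ?_ h
    exact Finset.single_le_sum (f := fun p => c p • e p) (fun _ _ => zero_le) (Finset.mem_univ p)
  · intro h x
    by_cases hx : ∃ p, e p x ≠ 0
    · obtain ⟨p, hp⟩ := hx
      rw [E_apply hd c p x hp]
      have := (le_al (he p)).1 (h p) x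
      simpa using this
    · push Not at hx
      rw [E, Finsupp.finsetSum_apply, Finset.sum_eq_zero]
      · exact Nat.zero_le _
      · intro p _; simp [hx p]

theorem al_add (he : ∀ p, e p ≠ 0) (hd : ∀ p q x, e p x ≠ 0 → e q x ≠ 0 → p = q)
    (a : σ →₀ ℕ) (p : τ) (c : τ → ℕ) : al (e p) (a + E e c) = al (e p) a + c p := by
  have key : ∀ n, n • e p ≤ a + E e c ↔ n ≤ al (e p) a + c p := by
    intro n
    rw [← Nat.sub_le_iff_le_add, le_al (he p)]
    constructor
    · intro h x
      by_cases hx : e p x = 0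
      · simp [hx]
      · have := h x
        simp only [Finsupp.add_apply, Finsupp.smul_apply, smul_eq_mul, E_apply hd c p x hx] at this ⊢
        rw [Nat.sub_mul]; omega
    · intro h x
      by_cases hx : e p x = 0
      · simp [hx]
      · have := h x
        simp only [Finsupp.add_apply, Finsupp.smul_apply, smul_eq_mul, E_apply hd c p x hx] at this ⊢
        rw [Nat.sub_mul] at this; omega
  refine le_antisymm ?_ ?_
  · exact (key _).1 ((le_al (he p)).1 le_rfl)
  · exact (le_al (he p)).2 ((key _).2 le_rfl)

variable (e)

def Phi (r : τ → MvPolynomial σ ℂ) : MvPolynomial σ ℂ →ₗ[ℂ] MvPolynomial σ ℂ :=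
  (basisMonomials σ ℂ).constr ℂ fun a =>
    (∏ p, r p ^ al (e p) a) * monomial (a - E e fun p => al (e p) a) 1

variable {e}

theorem Phi_monomial (r : τ → MvPolynomial σ ℂ) (a : σ →₀ ℕ) : Phi e r (monomial a 1) =
    (∏ p, r p ^ al (e p) a) * monomial (a - E e fun p => al (e p) a) 1 := by
  have := (basisMonomials σ ℂ).constr_basis ℂ (fun a =>
    (∏ p, r p ^ al (e p) a) * (monomial (a - E e fun p => al (e p) a) 1 : MvPolynomial σ ℂ)) a
  simpa [Phi] using this

theorem Phi_bij (he : ∀ p, e p ≠ 0) (hd : ∀ p q x, e p x ≠ 0 → e q x ≠ 0 → p = q)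
    (w : σ → ℕ) (r : τ → MvPolynomial σ ℂ) (hr : ∀ p, Ld w (r p) (e p)) :
    Function.Bijective (Phi e r) := by
  refine bij_of_Ld w _ fun a => ?_
  rw [Phi_monomial]
  have h1 : a = (E e fun p => al (e p) a) + (a - E e fun p => al (e p) a) := by
    rw [add_tsub_cancel_of_le]
    exact (E_le he hd _ _).2 fun p => le_rfl
  have h2 : Ld w ((∏ p, r p ^ al (e p) a) * monomial (a - E e fun p => al (e p) a) 1)
      ((E e fun p => al (e p) a) + (a - E e fun p => al (e p) a)) :=
    (Ld.prod _ fun p _ => (hr p).pow _).mul (Ld.monomial w _)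
  rwa [← h1] at h2

theorem Phi_monomial_add (he : ∀ p, e p ≠ 0) (hd : ∀ p q x, e p x ≠ 0 → e q x ≠ 0 → p = q)
    (r : τ → MvPolynomial σ ℂ) (a : σ →₀ ℕ) (c : τ → ℕ) :
    Phi e r (monomial (a + E e c) 1) = (∏ p, r p ^ c p) * Phi e r (monomial a 1) := by
  rw [Phi_monomial, Phi_monomial]
  simp only [al_add he hd]
  have : (E e fun p => al (e p) a + c p) = (E e fun p => al (e p) a) + E e c := by
    simp [E, add_smul, Finset.sum_add_distrib]
  rw [this, add_tsub_add_eq_tsub_right]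
  simp only [pow_add, Finset.prod_mul_distrib]
  ring

theorem Phi_mul (he : ∀ p, e p ≠ 0) (hd : ∀ p q x, e p x ≠ 0 → e q x ≠ 0 → p = q)
    (r : τ → MvPolynomial σ ℂ) (f : MvPolynomial σ ℂ) (c : τ → ℕ) :
    Phi e r (monomial (E e c) 1 * f) = (∏ p, r p ^ c p) * Phi e r f := by
  induction f using MvPolynomial.induction_on' with
  | monomial a z =>
    have : (monomial a z : MvPolynomial σ ℂ) = z • monomial a 1 := by
      rw [smul_monomial, smul_eq_mul, mul_one]
    rw [this, mul_smul_comm, map_smul, map_smul, mul_smul_comm, monomial_mul, one_mul, add_comm,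
      Phi_monomial_add he hd]
  | add p q hp hq => rw [mul_add, map_add, map_add, mul_add, hp, hq]

theorem indep (he : ∀ p, e p ≠ 0) (hd : ∀ p q x, e p x ≠ 0 → e q x ≠ 0 → p = q)
    (w : σ → ℕ) (r : τ → MvPolynomial σ ℂ) (hr : ∀ p, Ld w (r p) (e p))
    (s : Finset (τ →₀ ℕ)) (h : (τ →₀ ℕ) → MvPolynomial σ ℂ)
    (hsum : ∑ c ∈ s, (∏ p, r p ^ c p) * h c = 0)
    (hJ : ∀ c, h c ∈ Ideal.span (Set.range r) → h c = 0) : ∀ c ∈ s, h c = 0 := by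
  classical
  obtain ⟨hinj, hsurj⟩ := Phi_bij he hd w r hr
  choose g hg using fun c => hsurj (h c)
  have hs : ∑ c ∈ s, monomial (E e c) 1 * g c = 0 := by
    apply hinj
    rw [map_sum, map_zero, ← hsum]
    exact Finset.sum_congr rfl fun c _ => by rw [Phi_mul he hd, hg]
  by_contra hcon
  push Not at hcon
  obtain ⟨c0, hc0, hne0⟩ := hcon
  obtain ⟨c, hc⟩ := Finset.exists_minimal (s := s.filter fun c => h c ≠ 0) ⟨c0, by simp [hc0, hne0]⟩
  have hcs := hc.prop
  rw [Finset.mem_filter] at hcs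
  refine hcs.2 (hJ c ?_)
  have key : ∀ b ∈ (g c).support, ∃ p, e p ≤ b := by
    intro b hb
    by_contra hno
    push Not at hno
    have h0 : ∀ p, al (e p) b = 0 := by
      intro p
      by_contra hp
      have := (le_al (he p)).1 (Nat.one_le_iff_ne_zero.2 hp)
      rw [one_smul] at this
      exact hno p this
    have h1 := congrArg (coeff (b + E e c)) hs
    rw [coeff_sum, Finset.sum_eq_single c, coeff_zero, coeff_monomial_mul',
      if_pos (le_add_of_nonneg_left zero_le), add_tsub_cancel_right, one_mul] at h1
    · exact mem_support_iff.1 hb h1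
    · intro c' hc' hcc'
      rw [coeff_monomial_mul']
      split_ifs with hle
      · rw [E_le he hd] at hle
        have hle' : c' ≤ c := fun p => by
          have := hle p
          rwa [al_add he hd, h0, zero_add] at this
        have hz : h c' = 0 := by
          by_contra hz
          exact hcc' (le_antisymm hle' (hc.le_of_le (by simp [hc', hz]) hle'))
        have : g c' = 0 := hinj (by rw [hg, hz, map_zero])
        rw [this]; simp
      · rfl
    · intro h; exact absurd hcs.1 h
  rw [← hg c, (g c).as_sum, map_sum]
  refine sum_mem fun b hb => ?_
  obtain ⟨p, hp⟩ := key b hb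
  have h1 : (monomial b (coeff b (g c)) : MvPolynomial σ ℂ) =
      monomial (E e (Pi.single p 1)) 1 * monomial (b - e p) (coeff b (g c)) := by
    have : E e (Pi.single p 1) = e p := by
      rw [E, Finset.sum_eq_single p]
      · simp
      · intro q _ hq; simp [hq]
      · simp
    rw [this, monomial_mul, add_tsub_cancel_of_le hp, one_mul]
  rw [h1, Phi_mul he hd, Finset.prod_eq_single p]
  · rw [Pi.single_eq_same, pow_one]
    exact Ideal.mul_mem_right _ _ (Ideal.subset_span ⟨p, rfl⟩)
  · intro q _ hq; simp [hq]
  · simp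

end Free
end
end SepVar

namespace SepVar
open MvPolynomial Pointwise

noncomputable section

section Main
variable {m k : ℕ}

abbrev Pr (k : ℕ) := {p : Fin k × Fin k // p.1 ≤ p.2}

def rr (m k : ℕ) (p : Pr k) : Pscal m k := rP m k p.1.1 p.1.2

def lp (p : Pr k) : Pscal m k →ₗ[ℂ] Pscal m k := lap m k p.1.1 p.1.2

theorem lp_apply (p : Pr k) (f : Pscal m k) :
    lp p f = ∑ l : Fin m, pderiv (l, p.1.1) (pderiv (l, p.1.2) f) := by
  simp [lp, lap]

theorem mem_Harm (f : Pscal m k) : f ∈ Harm m k ↔ ∀ p : Pr k, lp p f = 0 := by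
  simp [Harm, lp]

theorem rr_mul (p : Pr k) (q : Pscal m k) :
    rr m k p * q = ∑ l : Fin m, X (l, p.1.2) * (X (l, p.1.1) * q) := by
  rw [rr, rP, Finset.sum_mul]
  exact Finset.sum_congr rfl fun l _ => by ring

theorem adj (p : Pr k) (q f : Pscal m k) : B (rr m k p * q) f = B q (lp p f) := by
  rw [rr_mul, lp_apply, B_sum, B_sum_right]
  exact Finset.sum_congr rfl fun l _ => by rw [B_X_mul, B_X_mul]

theorem lp_mem_D {n : ℕ} {f : Pscal m k} (p : Pr k) (h : f ∈ D _ n) : lp p f ∈ D _ (n - 2) := by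
  rw [lp_apply]
  exact sum_mem fun l _ => pderiv_mem_D _ (pderiv_mem_D _ h)

theorem rr_mem_D {n : ℕ} {f : Pscal m k} (p : Pr k) (h : f ∈ D _ n) :
    rr m k p * f ∈ D _ (n + 2) := by
  rw [rr_mul]
  exact sum_mem fun l _ => X_mul_mem_D _ (X_mul_mem_D _ h)

theorem harm_J {f : Pscal m k} (h : f ∈ Harm m k) (q : Pr k → Pscal m k)
    (hq : f = ∑ p, rr m k p * q p) : f = 0 := by
  apply eq_zero_of_B
  have : B f f = 0 := by
    conv_lhs => rw [hq]
    rw [B_sum]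
    refine Finset.sum_eq_zero fun p _ => ?_
    rw [adj, ← hq, (mem_Harm f).1 h p, B_zero_right]
  rw [this]; rfl

def AA (m k : ℕ) : Pscal m k →ₗ[ℂ] Pscal m k :=
  ∑ p : Pr k, LinearMap.mulLeft ℂ (rr m k p) ∘ₗ lp p

theorem AA_apply (f : Pscal m k) : AA m k f = ∑ p : Pr k, rr m k p * lp p f := by
  simp [AA]

theorem AA_ker {f : Pscal m k} (h : AA m k f = 0) : f ∈ Harm m k := by
  have h1 : B (AA m k f) f = 0 := by rw [h, B_zero_left]
  rw [AA_apply, B_sum] at h1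
  have h2 := congrArg Complex.re h1
  simp only [adj, Complex.re_sum, Complex.zero_re] at h2
  rw [Finset.sum_eq_zero_iff_of_nonneg fun p _ => B_self_nonneg _] at h2
  exact (mem_Harm f).2 fun p => eq_zero_of_B _ (h2 p (Finset.mem_univ _))

theorem decomp {n : ℕ} {f : Pscal m k} (hf : f ∈ D _ (n + 2)) :
    ∃ h ∈ Harm m k, ∃ g ∈ D (Fin m × Fin k) (n + 2), f = h + AA m k g := by
  have hA : ∀ x ∈ D (Fin m × Fin k) (n + 2), AA m k x ∈ D (Fin m × Fin k) (n + 2) := by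
    intro x hx
    rw [AA_apply]
    exact sum_mem fun p _ => rr_mem_D p (lp_mem_D p hx)
  let T := (AA m k).restrict hA
  have hdis : Disjoint (LinearMap.ker T) (LinearMap.range T) := by
    rw [Submodule.disjoint_def]
    rintro x hx ⟨y, rfl⟩
    have h1 : AA m k (T y : Pscal m k) = 0 := by
      have := congrArg Subtype.val (LinearMap.mem_ker.1 hx)
      simpa [T] using this
    have h2 : (T y : Pscal m k) = ∑ p, rr m k p * lp p (y : Pscal m k) := AA_apply _
    exact Subtype.ext (harm_J (AA_ker h1) _ h2)
  have hc : IsCompl (LinearMap.ker T) (LinearMap.range T) :=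
    (Submodule.isCompl_iff_disjoint _ _ (by
      have := LinearMap.finrank_range_add_finrank_ker T
      omega)).2 hdis
  have hmem : (⟨f, hf⟩ : D (Fin m × Fin k) (n + 2)) ∈ LinearMap.ker T ⊔ LinearMap.range T := by
    rw [hc.sup_eq_top]; trivial
  obtain ⟨x, hx, _, ⟨y, rfl⟩, hxy⟩ := Submodule.mem_sup.1 hmem
  refine ⟨x, AA_ker ?_, y, y.2, ?_⟩
  · have := congrArg Subtype.val (LinearMap.mem_ker.1 hx)
    simpa [T] using this
  · have := congrArg Subtype.val hxy
    simpa [T] using this.symm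

theorem surj_aux (R : Submodule ℂ (Pscal m k)) (h1 : Harm m k ≤ R)
    (h2 : ∀ p : Pr k, ∀ f ∈ R, rr m k p * f ∈ R) : ∀ n, D _ n ≤ R := by
  intro n
  induction n using Nat.strong_induction_on with
  | _ n ih =>
    intro f hf
    by_cases hn : n < 2
    · refine h1 ((mem_Harm f).2 fun p => D_zero ?_)
      have := lp_mem_D p hf
      rwa [show n - 2 = 0 by omega] at this
    · obtain ⟨n, rfl⟩ := Nat.exists_eq_add_of_le' (Nat.le_of_not_lt hn)
      obtain ⟨h, hh, g, hg, rfl⟩ := decomp hf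
      refine add_mem (h1 hh) ?_
      rw [AA_apply]
      exact sum_mem fun p _ => h2 p _ (ih n (by omega) (lp_mem_D p hg))

def ex (hr : 2 * k ≤ m) (p : Pr k) : Fin m × Fin k →₀ ℕ :=
  Finsupp.single (⟨p.1.1 + p.1.2, by omega⟩, p.1.1) 1 +
    Finsupp.single (⟨p.1.1 + p.1.2, by omega⟩, p.1.2) 1

theorem ex_ne (hr : 2 * k ≤ m) (p : Pr k) : ex hr p ≠ 0 := by
  intro h
  have := congrArg Finsupp.degree h
  simp [ex] at this

theorem ex_apply (hr : 2 * k ≤ m) (p : Pr k) (x : Fin m × Fin k) (h : ex hr p x ≠ 0) :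
    (x.1 : ℕ) = p.1.1 + p.1.2 ∧ (x.2 = p.1.1 ∨ x.2 = p.1.2) := by
  classical
  obtain ⟨l, i⟩ := x
  simp only [ex, Finsupp.add_apply, Finsupp.single_apply] at h
  split_ifs at h with h1 h2 h2
  · simp only [Prod.mk.injEq] at h1
    exact ⟨by rw [← h1.1], Or.inl h1.2.symm⟩
  · simp only [Prod.mk.injEq] at h1
    exact ⟨by rw [← h1.1], Or.inl h1.2.symm⟩
  · simp only [Prod.mk.injEq] at h2
    exact ⟨by rw [← h2.1], Or.inr h2.2.symm⟩
  · simp at h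

theorem ex_dis (hr : 2 * k ≤ m) (p q : Pr k) (x : Fin m × Fin k) (hp : ex hr p x ≠ 0)
    (hq : ex hr q x ≠ 0) : p = q := by
  obtain ⟨h1, h2⟩ := ex_apply hr p x hp
  obtain ⟨h3, h4⟩ := ex_apply hr q x hq
  obtain ⟨⟨i, j⟩, hij⟩ := p
  obtain ⟨⟨i', j'⟩, hij'⟩ := q
  have hij : (i : ℕ) ≤ j := hij
  have hij' : (i' : ℕ) ≤ j' := hij'
  simp only [Fin.ext_iff, Subtype.mk.injEq, Prod.mk.injEq] at *
  omega

def wt (m k : ℕ) (x : Fin m × Fin k) : ℕ :=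
  (((m : ℤ) + 2 * k) ^ 2 - ((x.1 : ℤ) - 2 * x.2) ^ 2).toNat

theorem wt_cast (x : Fin m × Fin k) :
    (wt m k x : ℤ) = ((m : ℤ) + 2 * k) ^ 2 - ((x.1 : ℤ) - 2 * x.2) ^ 2 := by
  refine Int.toNat_of_nonneg ?_
  have h1 := x.1.2
  have h2 := x.2.2
  rw [sub_nonneg]
  apply sq_le_sq' <;> omega

theorem rr_Ld (hr : 2 * k ≤ m) (p : Pr k) : Ld (wt m k) (rr m k p) (ex hr p) := by
  classical
  unfold Ld
  have hX : ∀ l : Fin m, (X (l, p.1.1) * X (l, p.1.2) : Pscal m k) =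
      monomial (Finsupp.single (l, p.1.1) 1 + Finsupp.single (l, p.1.2) 1) 1 := by
    intro l; rw [X, X, monomial_mul, one_mul]
  have hl : (p.1.1 + p.1.2 : ℕ) < m := by omega
  have h1 : rr m k p - monomial (ex hr p) 1 =
      ∑ l ∈ Finset.univ.erase (⟨p.1.1 + p.1.2, hl⟩ : Fin m), X (l, p.1.1) * X (l, p.1.2) := by
    rw [rr, rP, ← Finset.add_sum_erase _ _ (Finset.mem_univ (⟨p.1.1 + p.1.2, hl⟩ : Fin m)), hX, ex,
      add_sub_cancel_left]
  rw [h1]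
  refine sum_mem fun l hlm => ?_
  rw [hX]
  refine monomial_mem_F _ ?_
  have hne : (l : ℕ) ≠ p.1.1 + p.1.2 := fun h => Finset.ne_of_mem_erase hlm (Fin.ext h)
  simp only [ex, map_add, Finsupp.weight_single, one_smul]
  zify
  simp only [wt_cast]
  push_cast
  have hne' : (l : ℤ) - (p.1.1 + p.1.2) ≠ 0 := by
    intro h; apply hne; zify; linarith
  have := pow_pos (abs_pos.2 hne') 2
  rw [sq_abs] at this
  nlinarith

theorem inj_aux (hr : 2 * k ≤ m) (c : (Pr k →₀ ℕ) →₀ Harm m k)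
    (h : ∑ a ∈ c.support, (∏ p, rr m k p ^ a p) * (c a : Pscal m k) = 0) : c = 0 := by
  have := indep (ex_ne hr) (ex_dis hr) (wt m k) (rr m k) (rr_Ld hr) c.support
    (fun a => (c a : Pscal m k)) h (fun a ha => by
      obtain ⟨q, hq⟩ := (Ideal.mem_span_range_iff_exists_fun).1 ha
      refine harm_J (c a).2 q ?_
      rw [← hq]
      exact Finset.sum_congr rfl fun p _ => mul_comm _ _)
  ext1 a
  by_contra hne
  exact hne (Subtype.ext (this a (Finsupp.mem_support_iff.2 hne)))

end Main
end
end SepVar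

/-- Separation of variables in the stable range (Theorem 3.1(ii)): the multiplication map
I ⊗ H → P, where I is the algebra of invariants generated by the r²_ij and H is the space
of harmonic polynomials, is a linear isomorphism. -/
theorem separation_of_variables (m k : ℕ) (hm : 1 ≤ m) (hk : 1 ≤ k)
    (hrange : 2 * k ≤ m) :
    Function.Bijective
      (TensorProduct.lift ((LinearMap.mul ℂ (Pscal m k)).compl₁₂
        (Subalgebra.toSubmodule
          (Algebra.adjoin ℂ {q : Pscal m k | ∃ i j : Fin k, i ≤ j ∧ q = rP m k i j})).subtype
        (Harm m k).subtype)) := by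
  have hset : {q : Pscal m k | ∃ i j : Fin k, i ≤ j ∧ q = rP m k i j} =
      Set.range (SepVar.rr m k) := by
    ext q
    constructor
    · rintro ⟨i, j, hij, rfl⟩
      exact ⟨⟨(i, j), hij⟩, rfl⟩
    · rintro ⟨p, rfl⟩
      exact ⟨p.1.1, p.1.2, p.2, rfl⟩
  rw [hset]
  set I := Algebra.adjoin ℂ (Set.range (SepVar.rr m k)) with hI
  have hrI : ∀ p, SepVar.rr m k p ∈ I := fun p => Algebra.subset_adjoin ⟨p, rfl⟩
  set L := TensorProduct.lift ((LinearMap.mul ℂ (Pscal m k)).compl₁₂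
        (Subalgebra.toSubmodule I).subtype (Harm m k).subtype) with hL
  have hLt : ∀ (a : Subalgebra.toSubmodule I) (h : Harm m k),
      L (a ⊗ₜ h) = (a : Pscal m k) * (h : Pscal m k) := fun a h => rfl
  constructor
  · let π : MvPolynomial (SepVar.Pr k) ℂ →ₗ[ℂ] Subalgebra.toSubmodule I :=
      LinearMap.codRestrict _ (MvPolynomial.aeval (SepVar.rr m k)).toLinearMap (fun x => by
        change MvPolynomial.aeval (SepVar.rr m k) x ∈ I
        rw [hI, Algebra.adjoin_range_eq_range_aeval]
        exact ⟨x, rfl⟩)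
    have hπ : Function.Surjective π := by
      rintro ⟨x, hx⟩
      have hx' : x ∈ I := hx
      rw [hI, Algebra.adjoin_range_eq_range_aeval] at hx'
      obtain ⟨y, hy⟩ := hx'
      exact ⟨y, Subtype.ext hy⟩
    rw [injective_iff_map_eq_zero]
    intro t ht
    obtain ⟨t, rfl⟩ := LinearMap.rTensor_surjective (Harm m k) hπ t
    obtain ⟨c, rfl⟩ := TensorProduct.eq_repr_basis_left
      (MvPolynomial.basisMonomials (SepVar.Pr k) ℂ) t
    have hc : c = 0 := by
      apply SepVar.inj_aux hrange
      rw [Finsupp.sum, map_sum, map_sum] at ht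
      rw [← ht]
      refine Finset.sum_congr rfl fun a _ => ?_
      rw [LinearMap.rTensor_tmul, hLt]
      congr 1
      change _ = MvPolynomial.aeval (SepVar.rr m k) (MvPolynomial.monomial a 1)
      rw [MvPolynomial.aeval_monomial, map_one, one_mul, Finsupp.prod_fintype _ _ (by simp)]
    rw [hc]; simp
  · intro f
    obtain ⟨n, hn⟩ := SepVar.exists_mem_D f
    refine SepVar.surj_aux (LinearMap.range L) ?_ ?_ n hn
    · intro h hh
      exact ⟨⟨1, one_mem I⟩ ⊗ₜ ⟨h, hh⟩, by rw [hLt]; exact one_mul h⟩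
    · rintro p _ ⟨t, rfl⟩
      induction t using TensorProduct.induction_on with
      | zero => rw [map_zero, mul_zero]; exact zero_mem _
      | tmul a h =>
        refine ⟨⟨SepVar.rr m k p * a, I.mul_mem (hrI p) a.2⟩ ⊗ₜ h, ?_⟩
        rw [hLt, hLt]; exact mul_assoc _ _ _
      | add x y hx hy => rw [map_add, mul_add]; exact add_mem hx hy
end

section
/- Monogenics are generated from simplicial monogenics by raising operators (Lemma 4.2(ii)). Assume m ≥ 2k and let ℓ ∈ ℕ. Then M_ℓ equals the ℂ-linear span of all polynomials of the form E_{j_1 i_1} ∘ ⋯ ∘ E_{j_r i_r} (Q) with r ≥ 0, i_t < j_t for each t, and Q ∈ M^S_ℓ. Equivalently, M_ℓ is the smallest subspace of P⊗C_m containing M^S_ℓ and invariant under all operators E_ji with 1 ≤ i < j ≤ k. -/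
open scoped TensorProduct

noncomputable section

section Abs

/-- Abstract lemma: lowering operators generate everything from highest weight vectors. -/
lemma abs_gen {V ι : Type*} [AddCommGroup V] [Module ℂ V] [FiniteDimensional ℂ V]
    (c : InnerProductSpace.Core ℂ V) (F G : ι → Module.End ℂ V)
    (adj : ∀ i x y, c.inner (F i x) y = c.inner x (G i y)) (N : ℕ)
    (nil : ∀ L : List ι, L.length = N → (L.map F).prod = 0) (v : V) :
    v ∈ Submodule.span ℂ {x | ∃ (L : List ι) (q : V), (∀ i, G i q = 0) ∧ x = (L.map F).prod q} := by
  letI : NormedAddCommGroup V := c.toNormedAddCommGroup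
  letI : InnerProductSpace ℂ V := InnerProductSpace.ofCore c.toCore
  set W := Submodule.span ℂ {x | ∃ (L : List ι) (q : V), (∀ i, G i q = 0) ∧ x = (L.map F).prod q}
    with hW
  have key : ∀ n, ∀ L : List ι, L.length + n = N → ∀ x, (L.map F).prod x ∈ W := by
    intro n
    induction n with
    | zero =>
      intro L hL x
      rw [nil L (by simpa using hL)]
      simp
    | succ n ih =>
      intro L hL x
      let U : Submodule ℂ V := ⨆ i, LinearMap.range (F i)
      haveI : FiniteDimensional ℂ U := inferInstance
      obtain ⟨u, hu, w, hw, rfl⟩ := U.exists_add_mem_mem_orthogonal x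
      rw [map_add]
      refine W.add_mem ?_ ?_
      · have : U ≤ W.comap (L.map F).prod := by
          refine iSup_le fun i => ?_
          rintro _ ⟨y, rfl⟩
          have := ih (L ++ [i]) (by simp; omega) y
          simpa using this
        exact this hu
      · refine Submodule.subset_span ⟨L, w, fun i => ?_, rfl⟩
        have h1 : ∀ y, inner ℂ (F i y) w = 0 := fun y =>
          (Submodule.mem_orthogonal _ _).1 hw _ (Submodule.mem_iSup_of_mem i ⟨y, rfl⟩)
        have h2 := h1 (G i w)
        have h3 : c.inner (F i (G i w)) w = 0 := h2
        rw [adj] at h3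
        exact c.definite _ h3
  simpa using key N [] (by simp) v

end Abs

section Fis

variable {σ : Type*} (w : (σ →₀ ℕ) → ℂ)

/-- The weighted product on polynomials. -/
def fis (f g : MvPolynomial σ ℂ) : ℂ :=
  ∑ α ∈ f.support, w α * (starRingEnd ℂ) (f.coeff α) * g.coeff α

lemma fis_eq (f g : MvPolynomial σ ℂ) (s : Finset (σ →₀ ℕ)) (hs : f.support ⊆ s) :
    fis w f g = ∑ α ∈ s, w α * (starRingEnd ℂ) (f.coeff α) * g.coeff α := by
  refine Finset.sum_subset hs fun α _ h => ?_
  rw [MvPolynomial.notMem_support_iff.1 h]; simp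

lemma fis_add_left (f f' g : MvPolynomial σ ℂ) : fis w (f + f') g = fis w f g + fis w f' g := by
  classical
  rw [fis_eq w (f + f') g (f.support ∪ f'.support) MvPolynomial.support_add,
    fis_eq w f g (f.support ∪ f'.support) Finset.subset_union_left,
    fis_eq w f' g (f.support ∪ f'.support) Finset.subset_union_right, ← Finset.sum_add_distrib]
  refine Finset.sum_congr rfl fun α _ => ?_
  simp; ring

lemma fis_smul_left (r : ℂ) (f g : MvPolynomial σ ℂ) :
    fis w (r • f) g = (starRingEnd ℂ) r * fis w f g := by
  rw [fis_eq w (r • f) g f.support MvPolynomial.support_smul, fis, Finset.mul_sum]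
  refine Finset.sum_congr rfl fun α _ => ?_
  simp; ring

lemma fis_add_right (f g g' : MvPolynomial σ ℂ) : fis w f (g + g') = fis w f g + fis w f g' := by
  simp [fis, mul_add, Finset.sum_add_distrib]

lemma fis_zero_left (g : MvPolynomial σ ℂ) : fis w 0 g = 0 := by simp [fis]

lemma fis_zero_right (g : MvPolynomial σ ℂ) : fis w g 0 = 0 := by simp [fis]

lemma fis_sum_left {κ : Type*} (s : Finset κ) (f : κ → MvPolynomial σ ℂ) (g : MvPolynomial σ ℂ) :
    fis w (∑ i ∈ s, f i) g = ∑ i ∈ s, fis w (f i) g := by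
  classical
  induction s using Finset.induction_on with
  | empty => simp [fis_zero_left]
  | insert a s ha ih => rw [Finset.sum_insert ha, Finset.sum_insert ha, fis_add_left, ih]

lemma fis_sum_right {κ : Type*} (s : Finset κ) (f : κ → MvPolynomial σ ℂ) (g : MvPolynomial σ ℂ) :
    fis w g (∑ i ∈ s, f i) = ∑ i ∈ s, fis w g (f i) := by
  classical
  induction s using Finset.induction_on with
  | empty => simp [fis_zero_right]
  | insert a s ha ih => rw [Finset.sum_insert ha, Finset.sum_insert ha, fis_add_right, ih]

lemma fis_conj (hw : ∀ α, (starRingEnd ℂ) (w α) = w α) (f g : MvPolynomial σ ℂ) :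
    (starRingEnd ℂ) (fis w g f) = fis w f g := by
  classical
  rw [fis_eq w f g (f.support ∪ g.support) Finset.subset_union_left,
    fis_eq w g f (f.support ∪ g.support) Finset.subset_union_right, map_sum]
  refine Finset.sum_congr rfl fun α _ => ?_
  simp [hw]; ring

lemma fis_self (f : MvPolynomial σ ℂ) (u : (σ →₀ ℕ) → ℝ) :
    fis (fun α => (u α : ℂ)) f f = ((∑ α ∈ f.support, u α * ‖f.coeff α‖ ^ 2 : ℝ) : ℂ) := by
  rw [fis]
  push_cast
  refine Finset.sum_congr rfl fun α _ => ?_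
  rw [mul_assoc, ← Complex.conj_mul']

/-- The factorial weight. -/
def fw (α : σ →₀ ℕ) : ℝ := ∏ᶠ i, (Nat.factorial (α i) : ℝ)

lemma fw_pos [Finite σ] (α : σ →₀ ℕ) : 0 < fw α := by
  have := Fintype.ofFinite σ
  rw [fw, finprod_eq_prod_of_fintype]
  exact Finset.prod_pos fun i _ => by positivity

lemma fw_add [Finite σ] (α : σ →₀ ℕ) (s : σ) :
    fw (α + Finsupp.single s 1) = (α s + 1) * fw α := by
  classical
  have := Fintype.ofFinite σ
  rw [fw, fw, finprod_eq_prod_of_fintype, finprod_eq_prod_of_fintype,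
    ← Finset.mul_prod_erase _ _ (Finset.mem_univ s), ← Finset.mul_prod_erase _ (fun i => (Nat.factorial (α i) : ℝ)) (Finset.mem_univ s),
    ← mul_assoc]
  congr 1
  · simp [Nat.factorial_succ]
  · refine Finset.prod_congr rfl fun i hi => ?_
    have : s ≠ i := (Finset.ne_of_mem_erase hi).symm
    simp [Finsupp.single_apply, this]

/-- Fischer product. -/
def fsc (f g : MvPolynomial σ ℂ) : ℂ := fis (fun α => (fw α : ℂ)) f g

lemma fsc_conj (f g : MvPolynomial σ ℂ) : (starRingEnd ℂ) (fsc g f) = fsc f g :=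
  fis_conj _ (fun _ => Complex.conj_ofReal _) f g

lemma fsc_X_mul [Finite σ] (s : σ) (f g : MvPolynomial σ ℂ) :
    fsc (MvPolynomial.X s * f) g = fsc f (MvPolynomial.pderiv s g) := by
  classical
  have hmon : ∀ (α : σ →₀ ℕ) (c : ℂ) (g : MvPolynomial σ ℂ),
      fsc (MvPolynomial.monomial α c) g = fw α * (starRingEnd ℂ) c * g.coeff α := by
    intro α c g
    rw [fsc, fis_eq _ _ _ {α} MvPolynomial.support_monomial_subset]
    simp
  induction f using MvPolynomial.induction_on' with
  | monomial α c =>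
    have : (MvPolynomial.X s * MvPolynomial.monomial α c : MvPolynomial σ ℂ)
        = MvPolynomial.monomial (α + Finsupp.single s 1) c := by
      rw [MvPolynomial.X, MvPolynomial.monomial_mul, one_mul, add_comm]
    rw [this, hmon, hmon, MvPolynomial.coeff_pderiv, fw_add]
    push_cast
    ring
  | add p q hp hq =>
    rw [mul_add, fsc, fis_add_left, fsc, fis_add_left]
    exact congrArg₂ (· + ·) hp hq

lemma fsc_pderiv [Finite σ] (s : σ) (f g : MvPolynomial σ ℂ) :
    fsc (MvPolynomial.pderiv s f) g = fsc f (MvPolynomial.X s * g) := by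
  rw [← fsc_conj, ← fsc_X_mul, fsc_conj]

lemma fsc_self [Finite σ] (f : MvPolynomial σ ℂ) :
    ∃ r : ℝ, 0 ≤ r ∧ fsc f f = r ∧ (r = 0 → f = 0) := by
  refine ⟨_, ?_, fis_self f fw, ?_⟩
  · exact Finset.sum_nonneg fun α _ => mul_nonneg (fw_pos α).le (by positivity)
  · intro h
    rw [Finset.sum_eq_zero_iff_of_nonneg
      (fun α _ => mul_nonneg (fw_pos α).le (by positivity))] at h
    ext α
    by_contra hα
    have := h α (MvPolynomial.mem_support_iff.2 hα)
    rcases mul_eq_zero.1 this with h1 | h1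
    · exact (fw_pos α).ne' h1
    · exact hα (by simpa using h1)

end Fis

section Ops

variable {m k : ℕ}

/-- Scalar version of E_ij. -/
def Es (m k : ℕ) (i j : Fin k) : Pscal m k →ₗ[ℂ] Pscal m k :=
  ∑ l : Fin m, (LinearMap.mulLeft ℂ (MvPolynomial.X (l, i) : Pscal m k)) ∘ₗ
    (MvPolynomial.pderiv (l, j)).toLinearMap

lemma Es_apply (i j : Fin k) (p : Pscal m k) :
    Es m k i j p = ∑ l : Fin m, MvPolynomial.X (l, i) * MvPolynomial.pderiv (l, j) p := by
  simp [Es]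

lemma Eop_tmul (i j : Fin k) (p : Pscal m k) (c : Cl m) :
    Eop m k i j (p ⊗ₜ c) = Es m k i j p ⊗ₜ c := by
  simp [Eop, Es_apply, pd, TensorProduct.sum_tmul]

lemma Eop_eq (i j : Fin k) : Eop m k i j = LinearMap.rTensor (Cl m) (Es m k i j) := by
  refine TensorProduct.ext' fun p c => ?_
  rw [Eop_tmul, LinearMap.rTensor_tmul]

lemma fsc_Es (i j : Fin k) (f g : Pscal m k) : fsc (Es m k i j f) g = fsc f (Es m k j i g) := by
  rw [Es_apply, Es_apply, fsc, fsc, fis_sum_left, fis_sum_right]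
  refine Finset.sum_congr rfl fun l _ => ?_
  change fsc _ _ = fsc _ _
  rw [fsc_X_mul, fsc_pderiv]

lemma Es_coeff (i j : Fin k) (f : Pscal m k) (α : Fin m × Fin k →₀ ℕ)
    (h : (Es m k i j f).coeff α ≠ 0) :
    ∃ (l : Fin m) (γ : Fin m × Fin k →₀ ℕ), α = γ + Finsupp.single (l, i) 1 ∧
      f.coeff (γ + Finsupp.single (l, j) 1) ≠ 0 := by
  classical
  rw [Es_apply, MvPolynomial.coeff_sum] at h
  obtain ⟨l, _, hl⟩ := Finset.exists_ne_zero_of_sum_ne_zero h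
  rw [MvPolynomial.coeff_X_mul'] at hl
  split_ifs at hl with hs
  · rw [MvPolynomial.coeff_pderiv] at hl
    refine ⟨l, α - Finsupp.single (l, i) 1, ?_, left_ne_zero_of_mul hl⟩
    rw [Finsupp.sub_add_single_one_cancel (Finsupp.mem_support_iff.1 hs)]
  · exact absurd rfl hl

lemma Es_hom (i j : Fin k) (f : Pscal m k) (ℓ : ℕ) (hf : f ∈ Pdeg m k ℓ) :
    Es m k i j f ∈ Pdeg m k ℓ := by
  rw [MvPolynomial.mem_homogeneousSubmodule] at *
  intro α hα
  obtain ⟨l, γ, rfl, h⟩ := Es_coeff i j f α hα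
  have := hf h
  simp only [map_add, Finsupp.weight_single] at this ⊢
  simpa using this

lemma Eop_deg (i j : Fin k) (x : PC m k) (ℓ : ℕ) (hx : x ∈ PCdeg m k ℓ) :
    Eop m k i j x ∈ PCdeg m k ℓ := by
  obtain ⟨y, rfl⟩ := hx
  induction y using TensorProduct.induction_on with
  | zero => simp
  | add a b ha hb => rw [map_add, map_add]; exact Submodule.add_mem _ ha hb
  | tmul p c =>
    rw [LinearMap.rTensor_tmul, Eop_tmul]
    exact ⟨(⟨Es m k i j p.1, Es_hom i j p.1 ℓ p.2⟩ : Pdeg m k ℓ) ⊗ₜ c, by simp⟩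

lemma pderiv_comm' {σ : Type*} (s t : σ) (p : MvPolynomial σ ℂ) :
    MvPolynomial.pderiv s (MvPolynomial.pderiv t p)
      = MvPolynomial.pderiv t (MvPolynomial.pderiv s p) := by
  classical
  ext α
  simp only [MvPolynomial.coeff_pderiv, Finsupp.add_apply, Finsupp.single_apply]
  rw [add_right_comm]
  by_cases h : s = t
  · subst h; ring
  · simp [h, Ne.symm h]; ring

lemma pderiv_X_mul' {σ : Type*} (s t : σ) (q : MvPolynomial σ ℂ) [Decidable (t = s)] :
    MvPolynomial.pderiv s (MvPolynomial.X t * q) =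
      MvPolynomial.X t * MvPolynomial.pderiv s q + (if t = s then q else 0) := by
  rw [MvPolynomial.pderiv_mul, add_comm]
  split_ifs with h
  · subst h; rw [MvPolynomial.pderiv_X_self, one_mul]
  · rw [MvPolynomial.pderiv_X_of_ne h, zero_mul]

lemma pderiv_Es (l : Fin m) (a i j : Fin k) (p : Pscal m k) :
    MvPolynomial.pderiv (l, a) (Es m k i j p) =
      Es m k i j (MvPolynomial.pderiv (l, a) p)
        + (if a = i then MvPolynomial.pderiv (l, j) p else 0) := by
  rw [Es_apply, Es_apply, map_sum]
  have h : ∀ l' : Fin m, MvPolynomial.pderiv (l, a)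
      (MvPolynomial.X (l', i) * MvPolynomial.pderiv (l', j) p) =
      MvPolynomial.X (l', i) * MvPolynomial.pderiv (l', j) (MvPolynomial.pderiv (l, a) p)
      + (if l' = l then (if a = i then MvPolynomial.pderiv (l, j) p else 0) else 0) := by
    intro l'
    rw [pderiv_X_mul', pderiv_comm']
    congr 1
    by_cases h1 : l' = l
    · subst h1
      by_cases h2 : a = i
      · subst h2; simp only [if_true]
      · have h3 : ¬ ((l', i) : Fin m × Fin k) = (l', a) :=
          fun h' => h2 (Prod.ext_iff.1 h').2.symm
        rw [if_neg h3, if_pos rfl, if_neg h2]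
    · have h3 : ¬ ((l', i) : Fin m × Fin k) = (l, a) := fun h' => h1 (Prod.ext_iff.1 h').1
      rw [if_neg h3, if_neg h1]
  rw [Finset.sum_congr rfl fun l' _ => h l', Finset.sum_add_distrib, Finset.sum_ite_eq',
    if_pos (Finset.mem_univ l)]

lemma dirac_tmul (a : Fin k) (p : Pscal m k) (c : Cl m) :
    dirac m k a (p ⊗ₜ c) = ∑ l, MvPolynomial.pderiv (l, a) p ⊗ₜ (e m l * c) := by
  simp [dirac, pd]

lemma dirac_Eop (a i j : Fin k) (x : PC m k) :
    dirac m k a (Eop m k i j x) = Eop m k i j (dirac m k a x)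
      + (if a = i then dirac m k j x else 0) := by
  induction x using TensorProduct.induction_on with
  | zero => simp
  | add x y hx hy =>
    simp only [map_add, hx, hy]
    split_ifs <;> abel
  | tmul p c =>
    simp only [Eop_tmul, dirac_tmul, map_sum, pderiv_Es, TensorProduct.add_tmul,
      Finset.sum_add_distrib]
    split_ifs <;> simp

lemma Eop_mono (i j : Fin k) (x : PC m k) (hx : x ∈ Mono m k) : Eop m k i j x ∈ Mono m k := by
  simp only [Mono, Submodule.mem_iInf, LinearMap.mem_ker] at *
  intro a
  rw [dirac_Eop, hx, hx]; simp

/-- A basis of the Clifford algebra. -/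
def clb (m : ℕ) := Module.Basis.ofVectorSpace ℂ (Cl m)

/-- Components with respect to a basis of the Clifford algebra. -/
def ccmp (m k : ℕ) : PC m k ≃ₗ[ℂ] (Module.Basis.ofVectorSpaceIndex ℂ (Cl m) →₀ Pscal m k) :=
  letI := Classical.decEq (Module.Basis.ofVectorSpaceIndex ℂ (Cl m))
  TensorProduct.equivFinsuppOfBasisRight (clb m)

lemma cmp_rT (f : Pscal m k →ₗ[ℂ] Pscal m k) (x : PC m k) (b) :
    ccmp m k (LinearMap.rTensor (Cl m) f x) b = f (ccmp m k x b) := by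
  induction x using TensorProduct.induction_on with
  | zero => simp
  | add x y hx hy => simp only [map_add, Finsupp.add_apply, hx, hy]
  | tmul p c => simp [ccmp, TensorProduct.equivFinsuppOfBasisRight_apply_tmul_apply]

lemma cmp_Eop (i j : Fin k) (x : PC m k) (b) :
    ccmp m k (Eop m k i j x) b = Es m k i j (ccmp m k x b) := by
  rw [Eop_eq, cmp_rT]

lemma cmp_deg (ℓ : ℕ) (x : PC m k) (hx : x ∈ PCdeg m k ℓ) (b) : ccmp m k x b ∈ Pdeg m k ℓ := by
  obtain ⟨y, rfl⟩ := hx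
  induction y using TensorProduct.induction_on with
  | zero => simp
  | add x y hx hy => rw [map_add, map_add, Finsupp.add_apply]; exact Submodule.add_mem _ hx hy
  | tmul p c =>
    simp only [LinearMap.rTensor_tmul, ccmp,
      TensorProduct.equivFinsuppOfBasisRight_apply_tmul_apply]
    exact Submodule.smul_mem _ _ p.2

/-- The weight of a monomial. -/
def wt (α : Fin m × Fin k →₀ ℕ) : ℕ := Finsupp.weight (fun p : Fin m × Fin k => (p.2 : ℕ)) α

lemma wt_le (α : Fin m × Fin k →₀ ℕ) (ℓ : ℕ) (h : Finsupp.weight 1 α = ℓ) :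
    wt α ≤ k * ℓ := by
  subst h
  rw [wt, Finsupp.weight_apply, Finsupp.weight_apply, Finsupp.sum, Finsupp.sum, Finset.mul_sum]
  refine Finset.sum_le_sum fun p _ => ?_
  have := p.2.2
  simp only [smul_eq_mul, Pi.one_apply, mul_one]
  rw [mul_comm]
  exact Nat.mul_le_mul_right _ this.le

lemma word_wt (L : List {p : Fin k × Fin k // p.1 < p.2}) (x : PC m k) (b)
    (α : Fin m × Fin k →₀ ℕ)
    (h : (ccmp m k ((L.map fun p => Eop m k p.1.2 p.1.1).foldr (fun f x => f x) x) b).coeff α ≠ 0) :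
    L.length ≤ wt α := by
  induction L generalizing α with
  | nil => simp
  | cons p L ih =>
    simp only [List.map_cons, List.foldr_cons] at h
    rw [cmp_Eop] at h
    obtain ⟨l, γ, rfl, h2⟩ := Es_coeff _ _ _ _ h
    have := ih _ h2
    have hp : (p.1.1 : ℕ) < p.1.2 := p.2
    simp only [wt, map_add, Finsupp.weight_single, smul_eq_mul, List.length_cons] at this ⊢
    omega

/-- The finite-dimensional piece: monogenics of degree ℓ with components in `T`. -/
def VT (m k ℓ : ℕ) (T : Finset (Module.Basis.ofVectorSpaceIndex ℂ (Cl m))) :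
    Submodule ℂ (PC m k) :=
  (Mono m k ⊓ PCdeg m k ℓ) ⊓ ⨅ b : {b // b ∉ T},
    LinearMap.ker (Finsupp.lapply b.1 ∘ₗ (ccmp m k).toLinearMap)

variable {ℓ : ℕ} {T : Finset (Module.Basis.ofVectorSpaceIndex ℂ (Cl m))}

lemma mem_VT (x : PC m k) : x ∈ VT m k ℓ T ↔
    (x ∈ Mono m k ∧ x ∈ PCdeg m k ℓ) ∧ ∀ b, b ∉ T → ccmp m k x b = 0 := by
  simp [VT]

lemma VT_Eop (i j : Fin k) (x : PC m k) (hx : x ∈ VT m k ℓ T) : Eop m k i j x ∈ VT m k ℓ T := by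
  rw [mem_VT] at *
  refine ⟨⟨Eop_mono i j x hx.1.1, Eop_deg i j x ℓ hx.1.2⟩, fun b hb => ?_⟩
  rw [cmp_Eop, hx.2 b hb, map_zero]

lemma cmp_ext (x : PC m k) (hx : x ∈ VT m k ℓ T) (h : ∀ b ∈ T, ccmp m k x b = 0) : x = 0 := by
  rw [mem_VT] at hx
  apply (ccmp m k).injective
  rw [map_zero]
  ext1 b
  by_cases hb : b ∈ T
  · exact h b hb
  · exact hx.2 b hb

lemma VT_fin : FiniteDimensional ℂ (VT m k ℓ T) := by
  haveI : FiniteDimensional ℂ (Pdeg m k ℓ) :=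
    Module.Finite.iff_fg.2 (MvPolynomial.homogeneousSubmodule_fg _ _ _)
  let g : VT m k ℓ T →ₗ[ℂ] (T → Pdeg m k ℓ) := LinearMap.pi fun b =>
    LinearMap.codRestrict (Pdeg m k ℓ)
      ((Finsupp.lapply b.1 ∘ₗ (ccmp m k).toLinearMap) ∘ₗ (VT m k ℓ T).subtype)
      (fun x => cmp_deg ℓ x.1 ((mem_VT _).1 x.2).1.2 b.1)
  refine FiniteDimensional.of_injective g ?_
  intro x y hxy
  apply Subtype.ext
  rw [← sub_eq_zero]
  refine cmp_ext (x.1 - y.1) (Submodule.sub_mem _ x.2 y.2) fun b hb => ?_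
  rw [map_sub, Finsupp.sub_apply, sub_eq_zero]
  exact congrArg Subtype.val (congrFun hxy ⟨b, hb⟩)

/-- The inner product on the finite-dimensional piece. -/
def coreVT : InnerProductSpace.Core ℂ (VT m k ℓ T) where
  inner x y := ∑ b ∈ T, fsc (ccmp m k x.1 b) (ccmp m k y.1 b)
  conj_inner_symm x y := by
    rw [map_sum]; exact Finset.sum_congr rfl fun b _ => fsc_conj _ _
  re_inner_nonneg x := by
    rw [map_sum]
    refine Finset.sum_nonneg fun b _ => ?_
    obtain ⟨r, h0, h1, _⟩ := fsc_self (ccmp m k x.1 b)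
    rw [h1]; simpa using h0
  add_left x y z := by
    rw [← Finset.sum_add_distrib]
    refine Finset.sum_congr rfl fun b _ => ?_
    simp only [Submodule.coe_add, map_add, Finsupp.add_apply]
    exact fis_add_left _ _ _ _
  smul_left x y r := by
    rw [Finset.mul_sum]
    refine Finset.sum_congr rfl fun b _ => ?_
    simp only [Submodule.coe_smul, map_smul, Finsupp.smul_apply]
    exact fis_smul_left _ _ _ _
  definite x hx := by
    choose r h0 h1 h2 using fun b => fsc_self (ccmp m k x.1 b)
    simp only [h1] at hx
    have hx' : ∑ b ∈ T, r b = 0 := by exact_mod_cast hx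
    rw [Finset.sum_eq_zero_iff_of_nonneg (fun b _ => h0 b)] at hx'
    exact Subtype.ext (cmp_ext x.1 x.2 fun b hb => h2 b (hx' b hb))

/-- Restriction of the operators E_ij. -/
def ER (m k ℓ : ℕ) (T : Finset (Module.Basis.ofVectorSpaceIndex ℂ (Cl m))) (i j : Fin k) :
    Module.End ℂ (VT m k ℓ T) :=
  (Eop m k i j).restrict (VT_Eop i j)

lemma ER_word (L : List {p : Fin k × Fin k // p.1 < p.2}) (x : VT m k ℓ T) :
    (((L.map fun p => ER m k ℓ T p.1.2 p.1.1).prod x : VT m k ℓ T) : PC m k) =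
      (L.map fun p => Eop m k p.1.2 p.1.1).foldr (fun f x => f x) x.1 := by
  induction L with
  | nil => simp
  | cons p L ih =>
    simp only [List.map_cons, List.foldr_cons, List.prod_cons, Module.End.mul_apply]
    rw [← ih]; rfl

end Ops

end

/-- Monogenics are generated from simplicial monogenics by raising operators (Lemma 4.2(ii)):
M_ℓ is the linear span of all polynomials E_{j₁i₁} ∘ ⋯ ∘ E_{j_r i_r}(Q) with i_t < j_t and
Q ∈ M^S_ℓ. -/
theorem monogenics_from_simplicial (m k : ℕ) (hm : 1 ≤ m) (hk : 1 ≤ k)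
    (hrange : 2 * k ≤ m) (ℓ : ℕ) :
    Mono m k ⊓ PCdeg m k ℓ =
      Submodule.span ℂ
        {P : PC m k |
          ∃ (L : List {p : Fin k × Fin k // p.1 < p.2}) (Q : PC m k),
            Q ∈ SimpMono m k ⊓ PCdeg m k ℓ ∧
            P = (L.map fun p => Eop m k p.1.2 p.1.1).foldr (fun f x => f x) Q} := by
  apply le_antisymm
  · intro v hv
    let T := (ccmp m k v).support
    have hvT : v ∈ VT m k ℓ T := by
      rw [mem_VT]
      exact ⟨hv, fun b hb => Finsupp.notMem_support_iff.1 hb⟩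
    haveI : FiniteDimensional ℂ (VT m k ℓ T) := VT_fin
    have h := abs_gen (coreVT (m := m) (k := k) (ℓ := ℓ) (T := T))
      (fun p : {p : Fin k × Fin k // p.1 < p.2} => ER m k ℓ T p.1.2 p.1.1)
      (fun p => ER m k ℓ T p.1.1 p.1.2) ?_ (k * ℓ + 1) ?_ ⟨v, hvT⟩
    · have h' := Submodule.mem_map_of_mem (f := (VT m k ℓ T).subtype) h
      rw [Submodule.map_span] at h'
      refine Submodule.span_mono ?_ h'
      rintro _ ⟨_, ⟨L, q, hq, rfl⟩, rfl⟩
      refine ⟨L, q.1, ?_, ER_word L q⟩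
      have hq2 := (mem_VT _).1 q.2
      refine ⟨⟨hq2.1.1, ?_⟩, hq2.1.2⟩
      simp only [SetLike.mem_coe, Submodule.mem_iInf, LinearMap.mem_ker]
      intro p
      exact congrArg Subtype.val (hq p)
    · intro p x y
      refine Finset.sum_congr rfl fun b _ => ?_
      change fsc (ccmp m k (Eop m k _ _ x.1) b) _ = fsc _ (ccmp m k (Eop m k _ _ y.1) b)
      rw [cmp_Eop, cmp_Eop, fsc_Es]
    · intro L hL
      ext1 x
      apply Subtype.ext
      refine cmp_ext _ (Subtype.mem _) fun b _ => ?_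
      ext α
      by_contra hne
      have hd := cmp_deg ℓ _ ((mem_VT _).1 (Subtype.mem
        ((L.map fun p => ER m k ℓ T p.1.2 p.1.1).prod x))).1.2 b
      rw [MvPolynomial.mem_homogeneousSubmodule] at hd
      have h1 := wt_le α ℓ (hd hne)
      rw [ER_word] at hne
      have h2 := word_wt L x.1 b α hne
      omega
  · rw [Submodule.span_le]
    rintro _ ⟨L, Q, hQ, rfl⟩
    induction L with
    | nil => exact ⟨hQ.1.1, hQ.2⟩
    | cons p L ih =>
      exact ⟨Eop_mono _ _ _ ih.1, Eop_deg _ _ _ _ ih.2⟩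
end
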